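/- Time integrability of the kernel m: let φ be a rapidly decaying smooth solution of the Hartree equation with v(x) = χ(|x|)/|x|, where χ : [0,∞) → [0,∞) is smooth, compactly supported, and nonincreasing. Define m(t,x,y) := v(x−y) conj(φ(t,x)) conj(φ(t,y)). Then ∫_1^∞ ‖m(t,·,·)‖_{L²(ℝ³×ℝ³)} dt < ∞, i.e. ∫_1^∞ ( ∫∫ v(x−y)² |φ(t,x)|² |φ(t,y)|² dx dy )^{1/2} dt is finite. -/

import Mathlib

open MeasureTheory

noncomputable section

/-- Three-dimensional Euclidean space. -/
abbrev E3 : Type := EuclideanSpace ℝ (Fin 3)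

/-- Spatial Laplacian of a complex-valued function on `ℝ³`. -/
def lapC (f : E3 → ℂ) (x : E3) : ℂ :=
  ∑ j : Fin 3, fderiv ℝ (fun y => fderiv ℝ f y (EuclideanSpace.single j 1)) x
    (EuclideanSpace.single j 1)

/-- Spatial Laplacian of a real-valued function on `ℝ³`. -/
def lapR (f : E3 → ℝ) (x : E3) : ℝ :=
  ∑ j : Fin 3, fderiv ℝ (fun y => fderiv ℝ f y (EuclideanSpace.single j 1)) x
    (EuclideanSpace.single j 1)

/-- The Hartree self-interaction potential `W = v * |f|²` (convolution on `ℝ³`). -/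
def hartreeW (v : E3 → ℝ) (f : E3 → ℂ) (x : E3) : ℝ :=
  MeasureTheory.convolution v (fun y => ‖f y‖ ^ 2) (ContinuousLinearMap.lsmul ℝ ℝ) volume x

/-- A rapidly decaying smooth solution of the Hartree equation
`i ∂ₜ φ + Δφ − (v * |φ|²) φ = 0`:  `φ` is smooth on space-time, every spatial
Schwartz-type seminorm of every space-time derivative of `φ` is bounded on compact
time intervals, and the equation holds pointwise. -/
structure IsHartreeSolution (v : E3 → ℝ) (φ : ℝ → E3 → ℂ) : Prop where
  smooth : ContDiff ℝ (⊤ : ℕ∞) (fun p : ℝ × E3 => φ p.1 p.2)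
  decay : ∀ (k n : ℕ) (T : ℝ), ∃ C : ℝ, ∀ (t : ℝ) (x : E3), |t| ≤ T →
    ‖x‖ ^ k * ‖iteratedFDeriv ℝ n (fun p : ℝ × E3 => φ p.1 p.2) (t, x)‖ ≤ C
  eqn : ∀ (t : ℝ) (x : E3),
    Complex.I * deriv (fun s => φ s x) t + lapC (φ t) x
      - (hartreeW v (φ t) x : ℂ) * φ t x = 0

/-- Mass density `ρ = ½|φ|²`. -/
def rhoH (φ : ℝ → E3 → ℂ) (t : ℝ) (x : E3) : ℝ := (1 / 2 : ℝ) * ‖φ t x‖ ^ 2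

/-- The pseudoconformally rescaled profile `ψ_t(x) = e^{i|x|²/(4t)} φ(t,x)`. -/
def psiH (φ : ℝ → E3 → ℂ) (t : ℝ) (x : E3) : ℂ :=
  Complex.exp (Complex.I * ((‖x‖ ^ 2 : ℝ) / (4 * t))) * φ t x

/-- The pseudoconformal energy
`E_c(t) = t² ∫ ( |∇ψ_t|² + W ρ ) dx`. -/
def EcH (v : E3 → ℝ) (φ : ℝ → E3 → ℂ) (t : ℝ) : ℝ :=
  t ^ 2 * ∫ x : E3,
    ((∑ j : Fin 3, ‖fderiv ℝ (psiH φ t) x (EuclideanSpace.single j 1)‖ ^ 2)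
      + hartreeW v (φ t) x * rhoH φ t x)

/-- The pseudoconformal remainder
`R_c(t) = t ∫∫ ( −4V(|x−y|) − 2|x−y| V′(|x−y|) ) ρ(t,x) ρ(t,y) dx dy`. -/
def RcH (V : ℝ → ℝ) (φ : ℝ → E3 → ℂ) (t : ℝ) : ℝ :=
  t * ∫ x : E3, ∫ y : E3,
    (-4 * V ‖x - y‖ - 2 * ‖x - y‖ * deriv V ‖x - y‖) * rhoH φ t x * rhoH φ t y

/-- The remainder for the rescaled pseudoconformal energy:
`R_cc(t) = ∫ |∇ψ_t|² dx − 2 ∫∫ ( V(|x−y|) + |x−y| V′(|x−y|) ) ρ(t,x) ρ(t,y) dx dy`. -/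
def RccH (V : ℝ → ℝ) (φ : ℝ → E3 → ℂ) (t : ℝ) : ℝ :=
  (∫ x : E3, ∑ j : Fin 3, ‖fderiv ℝ (psiH φ t) x (EuclideanSpace.single j 1)‖ ^ 2)
    - 2 * ∫ x : E3, ∫ y : E3,
        (V ‖x - y‖ + ‖x - y‖ * deriv V ‖x - y‖) * rhoH φ t x * rhoH φ t y

/-- The hypotheses on the cut-off `χ` in the Coulomb-type potential `v(x) = χ(|x|)/|x|`:
`χ` is smooth, nonnegative, compactly supported and nonincreasing on `[0,∞)`. -/
structure IsCutoff (χ : ℝ → ℝ) : Prop where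
  smooth : ContDiff ℝ (⊤ : ℕ∞) χ
  nonneg : ∀ r, 0 ≤ χ r
  compact_supp : HasCompactSupport χ
  mono : AntitoneOn χ (Set.Ici 0)

/-- Directional derivative of a function on space-time. -/
def dirD (w : ℝ × E3) (f : ℝ × E3 → ℂ) (p : ℝ × E3) : ℂ := fderiv ℝ f p w

/-- The unit time direction. -/
def timeDir : ℝ × E3 := (1, 0)

/-- The `j`-th unit space direction. -/
def spaceDir (j : Fin 3) : ℝ × E3 := (0, EuclideanSpace.single j 1)

/-- The `j`-th space coordinate as a complex function on space-time. -/
def coordC (j : Fin 3) (p : ℝ × E3) : ℂ := ((p.2 j : ℝ) : ℂ)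

/-- Smooth functions on space-time whose derivatives grow at most polynomially in space, locally
uniformly in time. -/
structure LocTemperate (f : ℝ × E3 → ℂ) : Prop where
  smooth : ContDiff ℝ (⊤ : ℕ∞) f
  growth : ∀ (n : ℕ) (T : ℝ), ∃ (m : ℕ) (C : ℝ), ∀ (t : ℝ) (x : E3), |t| ≤ T →
    ‖iteratedFDeriv ℝ n f (t, x)‖ ≤ C * (1 + ‖x‖) ^ m

/-- Smooth functions on space-time whose derivatives decay rapidly in space, locally uniformly in
time. -/
structure LocSchwartz (f : ℝ × E3 → ℂ) : Prop where
  smooth : ContDiff ℝ (⊤ : ℕ∞) f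
  decay : ∀ (n k : ℕ) (T : ℝ), ∃ C : ℝ, ∀ (t : ℝ) (x : E3), |t| ≤ T →
    (1 + ‖x‖) ^ k * ‖iteratedFDeriv ℝ n f (t, x)‖ ≤ C

theorem LocSchwartz.locTemperate {f : ℝ × E3 → ℂ} (hf : LocSchwartz f) : LocTemperate f where
  smooth := hf.smooth
  growth n T := by
    obtain ⟨C, hC⟩ := hf.decay n 0 T
    exact ⟨0, C, fun t x ht => by simpa using hC t x ht⟩

theorem Function.HasTemperateGrowth.locTemperate {f : ℝ × E3 → ℂ}
    (hf : Function.HasTemperateGrowth f) : LocTemperate f where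
  smooth := hf.1
  growth n T := by
    obtain ⟨k, C, hC⟩ := hf.2 n
    have hC0 : 0 ≤ C := by simpa using (norm_nonneg _).trans (hC 0)
    refine ⟨k, C * (1 + |T|) ^ k, fun t x ht => (hC (t, x)).trans ?_⟩
    rw [mul_assoc, ← mul_pow]
    have h1 : ‖((t, x) : ℝ × E3)‖ ≤ |T| + ‖x‖ := by
      rw [Prod.norm_def]
      exact max_le (by
        have := le_abs_self T
        simp only [Real.norm_eq_abs]
        linarith [norm_nonneg x]) (by simp)
    gcongr
    nlinarith [norm_nonneg x, abs_nonneg T]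

theorem LocTemperate.mul_locSchwartz {f g : ℝ × E3 → ℂ} (hf : LocTemperate f)
    (hg : LocSchwartz g) : LocSchwartz (fun p => f p * g p) where
  smooth := hf.smooth.mul hg.smooth
  decay n k T := by
    choose m C hC using fun i => hf.growth i T
    choose C' hC' using fun i => hg.decay (n - i) (k + m i) T
    refine ⟨∑ i ∈ Finset.range (n + 1), (n.choose i : ℝ) * (C i * C' i), fun t x ht => ?_⟩
    have h := norm_iteratedFDeriv_mul_le (𝕜 := ℝ) hf.smooth hg.smooth (t, x) (n := n)
      (by exact_mod_cast le_top)
    refine (mul_le_mul_of_nonneg_left h (by positivity)).trans ?_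
    rw [Finset.mul_sum]
    refine Finset.sum_le_sum fun i _ => ?_
    have hx : 0 < 1 + ‖x‖ := by positivity
    have h1 := hC i t x ht
    have h2 := hC' i t x ht
    have hCi : 0 ≤ C i := by
      have := (norm_nonneg _).trans h1
      exact nonneg_of_mul_nonneg_left this (by positivity)
    calc (1 + ‖x‖) ^ k * ((n.choose i : ℝ) * ‖iteratedFDeriv ℝ i f (t, x)‖ *
          ‖iteratedFDeriv ℝ (n - i) g (t, x)‖)
        = (n.choose i : ℝ) * (‖iteratedFDeriv ℝ i f (t, x)‖ * ((1 + ‖x‖) ^ k *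
          ‖iteratedFDeriv ℝ (n - i) g (t, x)‖)) := by ring
      _ ≤ (n.choose i : ℝ) * (C i * (1 + ‖x‖) ^ m i * ((1 + ‖x‖) ^ k *
          ‖iteratedFDeriv ℝ (n - i) g (t, x)‖)) := by gcongr
      _ = (n.choose i : ℝ) * (C i * ((1 + ‖x‖) ^ (k + m i) *
          ‖iteratedFDeriv ℝ (n - i) g (t, x)‖)) := by rw [pow_add]; ring
      _ ≤ _ := by gcongr

theorem LocSchwartz.mul {f g : ℝ × E3 → ℂ} (hf : LocSchwartz f)
    (hg : LocSchwartz g) : LocSchwartz (fun p => f p * g p) :=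
  hf.locTemperate.mul_locSchwartz hg

theorem LocSchwartz.add {f g : ℝ × E3 → ℂ} (hf : LocSchwartz f)
    (hg : LocSchwartz g) : LocSchwartz (fun p => f p + g p) where
  smooth := hf.smooth.add hg.smooth
  decay n k T := by
    obtain ⟨C, hC⟩ := hf.decay n k T
    obtain ⟨C', hC'⟩ := hg.decay n k T
    refine ⟨C + C', fun t x ht => le_trans ?_ (add_le_add (hC t x ht) (hC' t x ht))⟩
    have h : iteratedFDeriv ℝ n (fun p => f p + g p) (t, x) =
        iteratedFDeriv ℝ n f (t, x) + iteratedFDeriv ℝ n g (t, x) :=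
      iteratedFDeriv_add_apply
        (hf.smooth.contDiffAt.of_le (by exact_mod_cast le_top))
        (hg.smooth.contDiffAt.of_le (by exact_mod_cast le_top))
    rw [h, ← mul_add]
    gcongr
    exact norm_add_le _ _

theorem LocSchwartz.const_mul {f : ℝ × E3 → ℂ} (hf : LocSchwartz f) (c : ℂ) :
    LocSchwartz (fun p => c * f p) :=
  (Function.HasTemperateGrowth.const c).locTemperate.mul_locSchwartz hf

theorem LocSchwartz.sub {f g : ℝ × E3 → ℂ} (hf : LocSchwartz f)
    (hg : LocSchwartz g) : LocSchwartz (fun p => f p - g p) := by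
  simpa [sub_eq_add_neg] using hf.add (hg.const_mul (-1))

theorem LocSchwartz.coord_mul {f : ℝ × E3 → ℂ} (hf : LocSchwartz f) (j : Fin 3) :
    LocSchwartz (fun p => coordC j p * f p) :=
  ((Complex.ofRealCLM ∘L (EuclideanSpace.proj j : E3 →L[ℝ] ℝ) ∘L
    ContinuousLinearMap.snd ℝ ℝ E3).hasTemperateGrowth).locTemperate.mul_locSchwartz hf

theorem LocSchwartz.sum {f : Fin 3 → ℝ × E3 → ℂ} (hf : ∀ j, LocSchwartz (f j)) :
    LocSchwartz (fun p => ∑ j, f j p) := by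
  simpa only [Fin.sum_univ_three] using ((hf 0).add (hf 1)).add (hf 2)

theorem LocSchwartz.comp_left {f : ℝ × E3 → ℂ} (hf : LocSchwartz f) (L : ℂ →L[ℝ] ℂ) :
    LocSchwartz (fun p => L (f p)) where
  smooth := L.contDiff.comp hf.smooth
  decay n k T := by
    obtain ⟨C, hC⟩ := hf.decay n k T
    refine ⟨‖L‖ * C, fun t x ht => ?_⟩
    have h := L.norm_iteratedFDeriv_comp_left (x := (t, x)) (n := n) hf.smooth.contDiffAt
      (by exact_mod_cast le_top)
    refine (mul_le_mul_of_nonneg_left h (by positivity)).trans ?_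
    rw [mul_left_comm]
    gcongr
    exact hC t x ht

theorem LocSchwartz.conj {f : ℝ × E3 → ℂ} (hf : LocSchwartz f) :
    LocSchwartz (fun p => starRingEnd ℂ (f p)) :=
  hf.comp_left (Complex.conjCLE : ℂ →L[ℝ] ℂ)

theorem LocSchwartz.dirD {f : ℝ × E3 → ℂ} (hf : LocSchwartz f) (w : ℝ × E3) :
    LocSchwartz (dirD w f) where
  smooth := (hf.smooth.fderiv_right (m := (⊤ : ℕ∞)) (by simp)).clm_apply contDiff_const
  decay n k T := by
    obtain ⟨C, hC⟩ := hf.decay (n + 1) k T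
    refine ⟨‖ContinuousLinearMap.apply ℝ ℂ w‖ * C, fun t x ht => ?_⟩
    have h := (ContinuousLinearMap.apply ℝ ℂ w).norm_iteratedFDeriv_comp_left
      (x := (t, x)) (n := n) (f := fderiv ℝ f) (N := (⊤ : ℕ∞))
      (hf.smooth.fderiv_right (m := (⊤ : ℕ∞)) (by simp)).contDiffAt
      (by exact_mod_cast le_top)
    rw [norm_iteratedFDeriv_fderiv] at h
    refine (mul_le_mul_of_nonneg_left h (by positivity)).trans ?_
    rw [mul_left_comm]
    gcongr
    exact hC t x ht

theorem LocSchwartz.differentiable {f : ℝ × E3 → ℂ} (hf : LocSchwartz f) : Differentiable ℝ f :=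
  hf.smooth.differentiable (by simp)

theorem LocSchwartz.continuous {f : ℝ × E3 → ℂ} (hf : LocSchwartz f) : Continuous f :=
  hf.smooth.continuous

theorem dirD_mul {f g : ℝ × E3 → ℂ} (hf : Differentiable ℝ f) (hg : Differentiable ℝ g)
    (w p : ℝ × E3) :
    dirD w (fun p => f p * g p) p = dirD w f p * g p + f p * dirD w g p := by
  unfold dirD
  rw [fderiv_fun_mul (hf p) (hg p)]
  simp
  ring

theorem dirD_add {f g : ℝ × E3 → ℂ} (hf : Differentiable ℝ f) (hg : Differentiable ℝ g)
    (w p : ℝ × E3) : dirD w (fun p => f p + g p) p = dirD w f p + dirD w g p := by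
  unfold dirD
  rw [fderiv_fun_add (hf p) (hg p)]
  rfl

theorem dirD_sub {f g : ℝ × E3 → ℂ} (hf : Differentiable ℝ f) (hg : Differentiable ℝ g)
    (w p : ℝ × E3) : dirD w (fun p => f p - g p) p = dirD w f p - dirD w g p := by
  unfold dirD
  rw [fderiv_fun_sub (hf p) (hg p)]
  rfl

theorem dirD_conj {f : ℝ × E3 → ℂ} (hf : Differentiable ℝ f) (w p : ℝ × E3) :
    dirD w (fun p => starRingEnd ℂ (f p)) p = starRingEnd ℂ (dirD w f p) := by
  have h := ((Complex.conjCLE : ℂ →L[ℝ] ℂ).hasFDerivAt.comp p (hf p).hasFDerivAt).fderiv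
  exact congrArg (fun L => L w) h

theorem differentiable_coordC (j : Fin 3) : Differentiable ℝ (coordC j) :=
  (Complex.ofRealCLM ∘L (EuclideanSpace.proj j : E3 →L[ℝ] ℝ) ∘L
    ContinuousLinearMap.snd ℝ ℝ E3).differentiable

theorem dirD_coordC (j : Fin 3) (w p : ℝ × E3) : dirD w (coordC j) p = coordC j w := by
  have h := (Complex.ofRealCLM ∘L (EuclideanSpace.proj j : E3 →L[ℝ] ℝ) ∘L
    ContinuousLinearMap.snd ℝ ℝ E3).fderiv (x := p)
  exact congrArg (fun L => L w) h

theorem LocSchwartz.dirD_comm {f : ℝ × E3 → ℂ} (hf : LocSchwartz f) (v w p : ℝ × E3) :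
    _root_.dirD v (_root_.dirD w f) p = _root_.dirD w (_root_.dirD v f) p := by
  have hd : DifferentiableAt ℝ (fderiv ℝ f) p :=
    (hf.smooth.fderiv_right (m := (⊤ : ℕ∞)) (by simp)).differentiable (by simp) p
  have key : ∀ a b : ℝ × E3, _root_.dirD a (_root_.dirD b f) p = fderiv ℝ (fderiv ℝ f) p a b := by
    intro a b
    unfold _root_.dirD
    rw [fderiv_clm_apply hd (differentiableAt_const b)]
    simp
  rw [key, key]
  exact (hf.smooth.contDiffAt.isSymmSndFDerivAt (by
    rw [minSmoothness_of_isRCLikeNormedField]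
    exact WithTop.coe_le_coe.2 le_top)) v w

theorem hasDerivAt_time {f : ℝ × E3 → ℂ} (hf : Differentiable ℝ f) (t : ℝ) (x : E3) :
    HasDerivAt (fun s => f (s, x)) (dirD timeDir f (t, x)) t :=
  (hf (t, x)).hasFDerivAt.comp_hasDerivAt t ((hasDerivAt_id t).prodMk (hasDerivAt_const t x))

theorem hasFDerivAt_space {f : ℝ × E3 → ℂ} (hf : Differentiable ℝ f) (t : ℝ) (x : E3) :
    HasFDerivAt (fun y => f (t, y)) (fderiv ℝ f (t, x) ∘L ContinuousLinearMap.inr ℝ ℝ E3) x :=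
  (hf (t, x)).hasFDerivAt.comp x (hasFDerivAt_prodMk_right t x)

theorem fderiv_space {f : ℝ × E3 → ℂ} (hf : Differentiable ℝ f) (t : ℝ) (x : E3) (j : Fin 3) :
    fderiv ℝ (fun y => f (t, y)) x (EuclideanSpace.single j 1) = dirD (spaceDir j) f (t, x) := by
  rw [(hasFDerivAt_space hf t x).fderiv]
  rfl

/-- An integrable majorant on `ℝ³`. -/
def decayWeight (x : E3) : ℝ := ((1 + ‖x‖) ^ 4)⁻¹

theorem decayWeight_le_one (x : E3) : decayWeight x ≤ 1 := by
  unfold decayWeight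
  exact inv_le_one_of_one_le₀ (one_le_pow₀ (by linarith [norm_nonneg x]))

theorem integrable_decayWeight : Integrable decayWeight := by
  have h := integrable_one_add_norm (E := E3) (μ := volume) (r := 4) (by simp; norm_num)
  refine h.congr (Filter.Eventually.of_forall fun x => ?_)
  have : (0 : ℝ) ≤ 1 + ‖x‖ := by positivity
  simp only [decayWeight]
  rw [Real.rpow_neg this]
  norm_cast

theorem LocSchwartz.exists_bound {f : ℝ × E3 → ℂ} (hf : LocSchwartz f) (T : ℝ) :
    ∃ C : ℝ, 0 ≤ C ∧ ∀ (t : ℝ) (x : E3), |t| ≤ T → ‖f (t, x)‖ ≤ C * decayWeight x := by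
  obtain ⟨C, hC⟩ := hf.decay 0 4 T
  refine ⟨|C|, abs_nonneg C, fun t x ht => ?_⟩
  have h := (hC t x ht).trans (le_abs_self C)
  rw [norm_iteratedFDeriv_zero] at h
  unfold decayWeight
  rw [← div_eq_mul_inv, le_div_iff₀ (by positivity), mul_comm]
  exact h

theorem LocSchwartz.integrable {f : ℝ × E3 → ℂ} (hf : LocSchwartz f) (t : ℝ) :
    Integrable (fun x => f (t, x)) := by
  obtain ⟨C, -, hC⟩ := hf.exists_bound |t|
  exact (integrable_decayWeight.const_mul C).mono'
    (hf.continuous.comp (by fun_prop)).aestronglyMeasurable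
    (Filter.Eventually.of_forall fun x => hC t x le_rfl)

theorem LocSchwartz.hasDerivAt_integral {f : ℝ × E3 → ℂ} (hf : LocSchwartz f) (t : ℝ) :
    HasDerivAt (fun s => ∫ x, f (s, x)) (∫ x, _root_.dirD timeDir f (t, x)) t := by
  obtain ⟨C, -, hC⟩ := (hf.dirD timeDir).exists_bound (|t| + 1)
  refine (hasDerivAt_integral_of_dominated_loc_of_deriv_le (Metric.ball_mem_nhds t one_pos)
    (Filter.Eventually.of_forall fun s => (hf.integrable s).aestronglyMeasurable)
    (hf.integrable t) ((hf.dirD timeDir).integrable t).aestronglyMeasurable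
    (Filter.Eventually.of_forall fun x s hs => hC s x ?_)
    (integrable_decayWeight.const_mul C)
    (Filter.Eventually.of_forall fun x s _ => hasDerivAt_time hf.differentiable s x)).2
  rw [Metric.mem_ball, Real.dist_eq] at hs
  have := abs_sub_abs_le_abs_sub s t
  linarith

theorem LocSchwartz.integral_spaceDir {f : ℝ × E3 → ℂ} (hf : LocSchwartz f) (t : ℝ) (j : Fin 3) :
    ∫ x, _root_.dirD (spaceDir j) f (t, x) = 0 := by
  have h := integral_mul_fderiv_eq_neg_fderiv_mul_of_integrable (μ := (volume : Measure E3))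
    (f := fun _ => (1 : ℂ)) (g := fun x => f (t, x)) (v := EuclideanSpace.single j 1)
    (by simp)
    (by
      simp only [fderiv_space hf.differentiable, one_mul]
      exact (hf.dirD _).integrable t)
    (by simpa using hf.integrable t) (by simp)
    (fun x _ => (hasFDerivAt_space hf.differentiable t x).differentiableAt)
  simpa [fderiv_space hf.differentiable] using h

/-- A rapidly decaying quantity integrates to the same value as its defect from a divergence. -/
theorem integral_eq_of_eq_div_add {g : ℝ × E3 → ℂ} (hg : LocSchwartz g)
    {F : Fin 3 → ℝ × E3 → ℂ} (hF : ∀ j, LocSchwartz (F j)) {r : E3 → ℂ} (t : ℝ)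
    (h : ∀ x, g (t, x) = (∑ j, dirD (spaceDir j) (F j) (t, x)) + r x) :
    Integrable r ∧ ∫ x, g (t, x) = ∫ x, r x := by
  have hr : r = fun x => g (t, x) - ∑ j, dirD (spaceDir j) (F j) (t, x) := by
    funext x
    rw [h x]
    ring
  have hi : Integrable (fun x => ∑ j, dirD (spaceDir j) (F j) (t, x)) :=
    integrable_finsetSum _ fun j _ => ((hF j).dirD _).integrable t
  refine ⟨hr ▸ (hg.integrable t).sub hi, ?_⟩
  rw [hr, integral_sub (hg.integrable t) hi,
    integral_finsetSum _ fun j _ => ((hF j).dirD _).integrable t]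
  simp [(hF _).integral_spaceDir]

@[fun_prop]
theorem contDiff_dirD {f : ℝ × E3 → ℂ} (hf : ContDiff ℝ (⊤ : ℕ∞) f) (w : ℝ × E3) :
    ContDiff ℝ (⊤ : ℕ∞) (dirD w f) :=
  (hf.fderiv_right (m := (⊤ : ℕ∞)) (by simp)).clm_apply contDiff_const

@[fun_prop]
theorem differentiable_dirD {f : ℝ × E3 → ℂ} (hf : ContDiff ℝ (⊤ : ℕ∞) f) (w : ℝ × E3) :
    Differentiable ℝ (dirD w f) :=
  (contDiff_dirD hf w).differentiable (by simp)

attribute [fun_prop] differentiable_coordC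

@[simp]
theorem coordC_timeDir (j : Fin 3) : coordC j timeDir = 0 := by
  simp [coordC, timeDir]

@[simp]
theorem coordC_spaceDir (j k : Fin 3) : coordC j (spaceDir k) = if j = k then 1 else 0 := by
  simp only [coordC, spaceDir, PiLp.single_apply]
  split_ifs <;> simp

@[simp]
theorem dirD_const (z : ℂ) (w p : ℝ × E3) : dirD w (fun _ => z) p = 0 := by
  simp [dirD]

section ConservationLaws

variable {f c : ℝ × E3 → ℂ} {W : ℝ × E3 → ℂ}

theorem integral_dirD_time_gradient (hf : LocSchwartz f) (hc : LocSchwartz c)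
    (ef : ∀ p, Complex.I * dirD timeDir f p + (∑ j, dirD (spaceDir j) (dirD (spaceDir j) f) p)
      - W p * f p = 0)
    (ec : ∀ p, -Complex.I * dirD timeDir c p + (∑ j, dirD (spaceDir j) (dirD (spaceDir j) c) p)
      - W p * c p = 0) (t : ℝ) :
    ∫ x, dirD timeDir (fun p => ∑ j, dirD (spaceDir j) f p * dirD (spaceDir j) c p) (t, x)
      = ∫ x, -(W (t, x) * dirD timeDir (fun p => f p * c p) (t, x)) := by
  refine (integral_eq_of_eq_div_add (.dirD (.sum fun j => (hf.dirD _).mul (hc.dirD _)) _)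
    (F := fun j p => dirD timeDir f p * dirD (spaceDir j) c p +
      dirD timeDir c p * dirD (spaceDir j) f p)
    (fun j => ((hf.dirD _).mul (hc.dirD _)).add ((hc.dirD _).mul (hf.dirD _))) t fun x => ?_).2
  have := hf.smooth
  have := hc.smooth
  have := hf.differentiable
  have := hc.differentiable
  have e1 := ef (t, x)
  have e2 := ec (t, x)
  simp only [Fin.sum_univ_three] at e1 e2 ⊢
  simp (disch := fun_prop) only [dirD_add, dirD_mul]
  simp only [hf.dirD_comm timeDir (spaceDir _), hc.dirD_comm timeDir (spaceDir _)]
  linear_combination - dirD timeDir f (t, x) * e2 - dirD timeDir c (t, x) * e1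

theorem integral_dirD_time_density (hf : LocSchwartz f) (hc : LocSchwartz c)
    (ef : ∀ p, Complex.I * dirD timeDir f p + (∑ j, dirD (spaceDir j) (dirD (spaceDir j) f) p)
      - W p * f p = 0)
    (ec : ∀ p, -Complex.I * dirD timeDir c p + (∑ j, dirD (spaceDir j) (dirD (spaceDir j) c) p)
      - W p * c p = 0) (t : ℝ) :
    ∫ x, dirD timeDir (fun p => f p * c p) (t, x) = 0 := by
  have h := (integral_eq_of_eq_div_add (.dirD (hf.mul hc) timeDir)
    (F := fun j p => Complex.I * (c p * dirD (spaceDir j) f p - f p * dirD (spaceDir j) c p))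
    (r := fun _ => 0)
    (fun j => ((hc.mul (hf.dirD _)).sub (hf.mul (hc.dirD _))).const_mul _) t fun x => ?_).2
  · rw [h, integral_zero]
  have := hf.smooth
  have := hc.smooth
  have := hf.differentiable
  have := hc.differentiable
  have e1 := ef (t, x)
  have e2 := ec (t, x)
  simp only [Fin.sum_univ_three] at e1 e2 ⊢
  simp (disch := fun_prop) only [dirD_sub, dirD_mul, dirD_const]
  linear_combination (- Complex.I * c (t, x)) * e1 + (Complex.I * f (t, x)) * e2 +
    (c (t, x) * dirD timeDir f (t, x) + f (t, x) * dirD timeDir c (t, x)) * Complex.I_sq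

theorem integral_dirD_time_moment (hf : LocSchwartz f) (hc : LocSchwartz c)
    (ef : ∀ p, Complex.I * dirD timeDir f p + (∑ j, dirD (spaceDir j) (dirD (spaceDir j) f) p)
      - W p * f p = 0)
    (ec : ∀ p, -Complex.I * dirD timeDir c p + (∑ j, dirD (spaceDir j) (dirD (spaceDir j) c) p)
      - W p * c p = 0) (t : ℝ) :
    ∫ x, dirD timeDir (fun p => ∑ j, coordC j p * (coordC j p * (f p * c p))) (t, x) =
      ∫ x, -2 * Complex.I * ∑ j, coordC j (t, x) *
        (c (t, x) * dirD (spaceDir j) f (t, x) - f (t, x) * dirD (spaceDir j) c (t, x)) := by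
  refine (integral_eq_of_eq_div_add
    (.dirD (.sum fun j => ((hf.mul hc).coord_mul j).coord_mul j) timeDir)
    (F := fun j p => Complex.I * ∑ k, coordC k p * (coordC k p *
      (c p * dirD (spaceDir j) f p - f p * dirD (spaceDir j) c p)))
    (fun j => (LocSchwartz.sum fun k => (((hc.mul (hf.dirD _)).sub
      (hf.mul (hc.dirD _))).coord_mul k).coord_mul k).const_mul _) t fun x => ?_).2
  have := hf.smooth
  have := hc.smooth
  have := hf.differentiable
  have := hc.differentiable
  have e1 := ef (t, x)
  have e2 := ec (t, x)
  simp only [Fin.sum_univ_three] at e1 e2 ⊢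
  simp (disch := fun_prop) only [dirD_add, dirD_sub, dirD_mul, dirD_const, dirD_coordC,
    coordC_timeDir, coordC_spaceDir]
  simp only [reduceIte, Fin.reduceEq]
  linear_combination (coordC 0 (t, x) ^ 2 + coordC 1 (t, x) ^ 2 + coordC 2 (t, x) ^ 2) *
    ((- Complex.I * c (t, x)) * e1 + (Complex.I * f (t, x)) * e2 +
    (c (t, x) * dirD timeDir f (t, x) + f (t, x) * dirD timeDir c (t, x)) * Complex.I_sq)

theorem integral_dirD_time_virial (hf : LocSchwartz f) (hc : LocSchwartz c)
    (ef : ∀ p, Complex.I * dirD timeDir f p + (∑ j, dirD (spaceDir j) (dirD (spaceDir j) f) p)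
      - W p * f p = 0)
    (ec : ∀ p, -Complex.I * dirD timeDir c p + (∑ j, dirD (spaceDir j) (dirD (spaceDir j) c) p)
      - W p * c p = 0) (t : ℝ) :
    ∫ x, dirD timeDir (fun p => ∑ j, coordC j p *
        (c p * dirD (spaceDir j) f p - f p * dirD (spaceDir j) c p)) (t, x) =
      ∫ x, (4 * Complex.I * (∑ j, dirD (spaceDir j) f (t, x) * dirD (spaceDir j) c (t, x))
        + Complex.I * (W (t, x) * (6 * (f (t, x) * c (t, x)) +
          2 * ∑ j, coordC j (t, x) * dirD (spaceDir j) (fun p => f p * c p) (t, x)))) := by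
  refine (integral_eq_of_eq_div_add
    (.dirD (.sum fun j => ((hc.mul (hf.dirD _)).sub (hf.mul (hc.dirD _))).coord_mul j) timeDir)
    (F := fun j p =>
      coordC j p * (c p * dirD timeDir f p - f p * dirD timeDir c p)
      - 3 * Complex.I * (f p * dirD (spaceDir j) c p + c p * dirD (spaceDir j) f p)
      - 2 * Complex.I * ((∑ k, coordC k p * (dirD (spaceDir k) c p * dirD (spaceDir j) f p +
          dirD (spaceDir k) f p * dirD (spaceDir j) c p)) -
        coordC j p * ∑ k, dirD (spaceDir k) f p * dirD (spaceDir k) c p))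
    (fun j => ((((hc.mul (hf.dirD _)).sub (hf.mul (hc.dirD _))).coord_mul j).sub
      (((hf.mul (hc.dirD _)).add (hc.mul (hf.dirD _))).const_mul _)).sub
      (((LocSchwartz.sum fun k => (((hc.dirD _).mul (hf.dirD _)).add
        ((hf.dirD _).mul (hc.dirD _))).coord_mul k).sub
        ((LocSchwartz.sum fun k => (hf.dirD _).mul (hc.dirD _)).coord_mul j)).const_mul _))
    t fun x => ?_).2
  have := hf.smooth
  have := hc.smooth
  have := hf.differentiable
  have := hc.differentiable
  have e1 := ef (t, x)
  have e2 := ec (t, x)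
  simp only [Fin.sum_univ_three] at e1 e2 ⊢
  simp (disch := fun_prop) only [dirD_add, dirD_sub, dirD_mul, dirD_const, dirD_coordC,
    coordC_timeDir, coordC_spaceDir]
  simp only [reduceIte, Fin.reduceEq, hf.dirD_comm timeDir (spaceDir _),
    hc.dirD_comm timeDir (spaceDir _), hf.dirD_comm (spaceDir 2) (spaceDir 1),
    hf.dirD_comm (spaceDir 2) (spaceDir 0), hf.dirD_comm (spaceDir 1) (spaceDir 0),
    hc.dirD_comm (spaceDir 2) (spaceDir 1),
    hc.dirD_comm (spaceDir 2) (spaceDir 0), hc.dirD_comm (spaceDir 1) (spaceDir 0)]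
  linear_combination Complex.I * (3 * c (t, x) + 2 * (coordC 0 (t, x) * dirD (spaceDir 0) c (t, x) +
      coordC 1 (t, x) * dirD (spaceDir 1) c (t, x) + coordC 2 (t, x) * dirD (spaceDir 2) c (t, x))) * e1 + Complex.I * (3 * f (t, x) + 2 * (coordC 0 (t, x) * dirD (spaceDir 0) f (t, x) +
      coordC 1 (t, x) * dirD (spaceDir 1) f (t, x) + coordC 2 (t, x) * dirD (spaceDir 2) f (t, x))) * e2 +
    ((3 * f (t, x) + 2 * (coordC 0 (t, x) * dirD (spaceDir 0) f (t, x) +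
      coordC 1 (t, x) * dirD (spaceDir 1) f (t, x) + coordC 2 (t, x) * dirD (spaceDir 2) f (t, x))) * dirD timeDir c (t, x) - (3 * c (t, x) + 2 * (coordC 0 (t, x) * dirD (spaceDir 0) c (t, x) +
      coordC 1 (t, x) * dirD (spaceDir 1) c (t, x) + coordC 2 (t, x) * dirD (spaceDir 2) c (t, x))) * dirD timeDir f (t, x)) * Complex.I_sq

end ConservationLaws

/-- The Sobolev inequality `‖u‖₆ ≤ C ‖∇u‖₂` on `ℝ³` without any support assumption. -/
theorem eLpNorm_six_le_eLpNorm_fderiv_two : ∃ C : NNReal, ∀ u : E3 → ℂ, ContDiff ℝ 1 u →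
    MemLp u 2 volume → eLpNorm u 6 volume ≤ C * eLpNorm (fderiv ℝ u) 2 volume := by
  refine ⟨SNormLESNormFDerivOfEqConst ℂ (volume : Measure E3) (2 : NNReal), fun u hu hu2 => ?_⟩
  set S : ENNReal := ((SNormLESNormFDerivOfEqConst ℂ (volume : Measure E3) (2 : NNReal) : NNReal) :
    ENNReal) with hS
  let η : ContDiffBump (0 : E3) := ⟨1, 2, one_pos, one_lt_two⟩
  have hη : ContDiff ℝ 1 (η : E3 → ℝ) := η.contDiff
  obtain ⟨D, hD⟩ := (hη.continuous_fderiv (by simp)).bounded_above_of_compact_support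
    (η.hasCompactSupport.fderiv (𝕜 := ℝ))
  have hD0 : 0 ≤ D := (norm_nonneg _).trans (hD 0)
  let r : ℕ → ℝ := fun n => ((n : ℝ) + 1)⁻¹
  have hr0 : ∀ n, 0 < r n := fun n => by positivity
  have hr : Filter.Tendsto r Filter.atTop (nhds 0) := by
    simpa [r] using tendsto_one_div_add_atTop_nhds_zero_nat (𝕜 := ℝ)
  let w : ℕ → E3 → ℂ := fun n x => η (r n • x) • u x
  have hηn : ∀ n, ContDiff ℝ 1 (fun x => η (r n • x)) := fun n =>
    hη.comp (contDiff_const_smul (r n))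
  have hw : ∀ n, ContDiff ℝ 1 (w n) := fun n => (hηn n).smul hu
  have hwc : ∀ n, HasCompactSupport (w n) := fun n =>
    (η.hasCompactSupport.comp_smul (hr0 n).ne').smul_right
  have hfd : ∀ n x, ‖fderiv ℝ (w n) x‖ ≤ ‖‖fderiv ℝ u x‖ + (r n * D) * ‖u x‖‖ := by
    intro n x
    have h1 : fderiv ℝ (w n) x = η (r n • x) • fderiv ℝ u x +
        (fderiv ℝ (fun x => η (r n • x)) x).smulRight (u x) :=
      fderiv_fun_smul ((hηn n).differentiable (by simp) x) (hu.differentiable (by simp) x)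
    have h2 : ‖fderiv ℝ (fun x => η (r n • x)) x‖ ≤ r n * D := by
      rw [fderiv_comp_smul, norm_smul, Real.norm_of_nonneg (hr0 n).le]
      exact mul_le_mul_of_nonneg_left (hD _) (hr0 n).le
    rw [h1, Real.norm_of_nonneg (by have := hr0 n; positivity)]
    refine (norm_add_le _ _).trans (add_le_add ?_ ?_)
    · rw [norm_smul, Real.norm_of_nonneg η.nonneg]
      exact mul_le_of_le_one_left (norm_nonneg _) η.le_one
    · rw [ContinuousLinearMap.norm_smulRight_apply]
      exact mul_le_mul_of_nonneg_right h2 (norm_nonneg _)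
  have hbound : ∀ n, eLpNorm (w n) 6 volume ≤
      S * (eLpNorm (fderiv ℝ u) 2 volume + ENNReal.ofReal (r n * D) * eLpNorm u 2 volume) := by
    intro n
    have h1 := eLpNorm_le_eLpNorm_fderiv_of_eq (volume : Measure E3) (hw n) (hwc n)
      (p := 2) (p' := 6) (by norm_num) (by simp) (by simp; norm_num)
    refine h1.trans (mul_le_mul_right ?_ S)
    refine (eLpNorm_mono (hfd n)).trans ?_
    have hm1 : AEStronglyMeasurable (fun x => ‖fderiv ℝ u x‖) (volume : Measure E3) :=
      (hu.continuous_fderiv (by simp)).norm.aestronglyMeasurable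
    have hm2 : AEStronglyMeasurable (fun x => (r n * D) * ‖u x‖) (volume : Measure E3) :=
      (continuous_const.mul hu.continuous.norm).aestronglyMeasurable
    refine (eLpNorm_add_le hm1 hm2 (by simp)).trans ?_
    have h3 : eLpNorm (fun x => (r n * D) * ‖u x‖) 2 (volume : Measure E3) =
        ENNReal.ofReal (r n * D) * eLpNorm u 2 volume := by
      have := eLpNorm_const_smul (r n * D) (fun x => ‖u x‖) 2 (volume : Measure E3)
      rw [eLpNorm_norm] at this
      rw [← Real.enorm_of_nonneg (mul_nonneg (hr0 n).le hD0), ← this]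
      rfl
    have h4 : eLpNorm (fun x => ‖fderiv ℝ u x‖) 2 (volume : Measure E3) =
      eLpNorm (fderiv ℝ u) 2 volume := eLpNorm_norm _
    rw [ENNReal.coe_ofNat, h3, h4]
  have hlim : ∀ x, Filter.Tendsto (fun n => w n x) Filter.atTop (nhds (u x)) := by
    intro x
    have h1 : Filter.Tendsto (fun n => r n • x) Filter.atTop (nhds (0 : E3)) := by
      simpa using hr.smul_const x
    have h2 : Filter.Tendsto (fun n => η (r n • x)) Filter.atTop (nhds (η 0)) :=
      (hη.continuous.tendsto 0).comp h1
    have h3 : η (0 : E3) = 1 := η.one_of_mem_closedBall (by simp [η])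
    rw [h3] at h2
    simpa only [one_smul] using h2.smul_const (u x)
  have hrhs : Filter.Tendsto (fun n => S * (eLpNorm (fderiv ℝ u) 2 volume +
      ENNReal.ofReal (r n * D) * eLpNorm u 2 volume)) Filter.atTop
      (nhds (S * (eLpNorm (fderiv ℝ u) 2 volume + ENNReal.ofReal (0 * D) *
        eLpNorm u 2 volume))) := by
    refine ENNReal.Tendsto.const_mul ?_ (Or.inr (by simp [hS]))
    refine tendsto_const_nhds.add ?_
    exact ENNReal.Tendsto.mul_const (ENNReal.tendsto_ofReal (hr.mul_const D)) (Or.inr hu2.2.ne)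
  refine (Lp.eLpNorm_lim_le_liminf_eLpNorm
    (fun n => (hw n).continuous.aestronglyMeasurable) u
    (Filter.Eventually.of_forall hlim)).trans ?_
  refine (Filter.liminf_le_liminf (Filter.Eventually.of_forall hbound)).trans ?_
  rw [hrhs.liminf_eq]
  simp

theorem lintegral_pow_four_le (u : E3 → ℂ) (hu : AEMeasurable u) :
    ∫⁻ x, ‖u x‖ₑ ^ 4 ≤ eLpNorm u 2 volume * eLpNorm u 6 volume ^ 3 := by
  have h := ENNReal.lintegral_mul_le_Lp_mul_Lq (volume : Measure E3) Real.HolderConjugate.two_two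
    (f := fun x => ‖u x‖ₑ) (g := fun x => ‖u x‖ₑ ^ 3) hu.enorm (hu.enorm.pow_const 3)
  have e1 : (fun x => ‖u x‖ₑ ^ 4) = (fun x => ‖u x‖ₑ) * (fun x => ‖u x‖ₑ ^ 3) := by
    funext x
    simp only [Pi.mul_apply]
    ring
  rw [e1]
  refine h.trans (le_of_eq ?_)
  rw [eLpNorm_eq_lintegral_rpow_enorm_toReal (by simp) (by simp),
    eLpNorm_eq_lintegral_rpow_enorm_toReal (by simp) (by simp)]
  congr 1
  rw [← ENNReal.rpow_natCast, ← ENNReal.rpow_mul]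
  simp only [ENNReal.toReal_ofNat]
  norm_num
  congr 1
  refine lintegral_congr fun x => ?_
  rw [← ENNReal.rpow_natCast, ← ENNReal.rpow_natCast]
  norm_num
  ring

/-- The Gagliardo–Nirenberg inequality `‖u‖₄⁴ ≤ C ‖u‖₂ ‖∇u‖₂³` on `ℝ³`. -/
theorem integral_norm_pow_four_le : ∃ C : ℝ, 0 ≤ C ∧ ∀ u : E3 → ℂ, ContDiff ℝ 1 u →
    Integrable (fun x => ‖u x‖ ^ 2) → Integrable (fun x => ‖fderiv ℝ u x‖ ^ 2) →
    ∫ x, ‖u x‖ ^ 4 ≤ C * (√(∫ x, ‖u x‖ ^ 2) * √(∫ x, ‖fderiv ℝ u x‖ ^ 2) ^ 3) := by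
  obtain ⟨S, hS⟩ := eLpNorm_six_le_eLpNorm_fderiv_two
  refine ⟨S ^ 3, by positivity, fun u hu h1 h2 => ?_⟩
  have m1 : MemLp u 2 volume :=
    (memLp_two_iff_integrable_sq_norm hu.continuous.aestronglyMeasurable).2 h1
  have m2 : MemLp (fderiv ℝ u) 2 volume :=
    (memLp_two_iff_integrable_sq_norm
      (hu.continuous_fderiv (by simp)).aestronglyMeasurable).2 h2
  have key := (lintegral_pow_four_le u hu.continuous.measurable.aemeasurable).trans
    (mul_le_mul_right (pow_le_pow_left₀ bot_le (hS u hu m1) 3) _)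
  rw [m1.eLpNorm_eq_integral_rpow_norm (by simp) (by simp),
    m2.eLpNorm_eq_integral_rpow_norm (by simp) (by simp)] at key
  simp only [ENNReal.toReal_ofNat, Real.rpow_ofNat] at key
  rw [show (2 : ℝ)⁻¹ = 1 / 2 by norm_num, ← Real.sqrt_eq_rpow, ← Real.sqrt_eq_rpow] at key
  have e : (S : ENNReal) = ENNReal.ofReal (S : ℝ) := by simp
  rw [e, ← ENNReal.ofReal_mul (by positivity), ← ENNReal.ofReal_pow (by positivity),
    ← ENNReal.ofReal_mul (by positivity)] at key
  rw [integral_eq_lintegral_of_nonneg_ae (f := fun x => ‖u x‖ ^ 4) (Filter.Eventually.of_forall fun x => by positivity)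
    (hu.continuous.norm.pow 4).aestronglyMeasurable]
  refine ENNReal.toReal_le_of_le_ofReal (by positivity) ?_
  have e2 : ∀ x, ENNReal.ofReal (‖u x‖ ^ 4) = ‖u x‖ₑ ^ 4 := fun x => by
    rw [ENNReal.ofReal_pow (norm_nonneg _), ofReal_norm]
  simp only [e2]
  refine key.trans (ENNReal.ofReal_le_ofReal (le_of_eq (by ring)))

section Potential

variable {v : E3 → ℝ} {χ : ℝ → ℝ}

theorem ae_ne_zero_E3 : ∀ᵐ x : E3, x ≠ 0 := by
  simp [ae_iff]

theorem potential_even (hv : ∀ x : E3, x ≠ 0 → v x = χ ‖x‖ / ‖x‖) (x : E3) : v (-x) = v x := by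
  rcases eq_or_ne x 0 with rfl | hx
  · simp
  · rw [hv x hx, hv (-x) (neg_ne_zero.2 hx), norm_neg]

theorem potential_nonneg (hχ : IsCutoff χ) (hv : ∀ x : E3, x ≠ 0 → v x = χ ‖x‖ / ‖x‖) :
    ∀ᵐ x, 0 ≤ v x := by
  filter_upwards [ae_ne_zero_E3] with x hx
  rw [hv x hx]
  exact div_nonneg (hχ.nonneg _) (norm_nonneg _)

theorem integrable_potential (hχ : IsCutoff χ) (hv : ∀ x : E3, x ≠ 0 → v x = χ ‖x‖ / ‖x‖) :
    Integrable v := by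
  have h : Integrable (fun x : E3 => χ ‖x‖ / ‖x‖) := by
    refine (integrable_fun_norm_addHaar (volume : Measure E3) (f := fun y => χ y / y)).2 ?_
    have h1 : IntegrableOn (fun y => y * χ y) (Set.Ioi 0) :=
      ((continuous_id.mul hχ.smooth.continuous).integrable_of_hasCompactSupport
        hχ.compact_supp.mul_left).integrableOn
    refine h1.congr_fun (fun y hy => ?_) measurableSet_Ioi
    have : y ≠ 0 := (Set.mem_Ioi.1 hy).ne'
    simp only [finrank_euclideanSpace, Fintype.card_fin, smul_eq_mul]
    field_simp
    exact mul_comm _ _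
  exact h.congr (ae_ne_zero_E3.mono fun x hx => (hv x hx).symm)

theorem integrable_potential_sq (hχ : IsCutoff χ)
    (hv : ∀ x : E3, x ≠ 0 → v x = χ ‖x‖ / ‖x‖) : Integrable (fun x => v x ^ 2) := by
  have h : Integrable (fun x : E3 => (χ ‖x‖ / ‖x‖) ^ 2) := by
    refine (integrable_fun_norm_addHaar (volume : Measure E3) (f := fun y => (χ y / y) ^ 2)).2 ?_
    have h1 : IntegrableOn (fun y => χ y * χ y) (Set.Ioi 0) :=
      ((hχ.smooth.continuous.mul hχ.smooth.continuous).integrable_of_hasCompactSupport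
        hχ.compact_supp.mul_left).integrableOn
    refine h1.congr_fun (fun y hy => ?_) measurableSet_Ioi
    have : y ≠ 0 := (Set.mem_Ioi.1 hy).ne'
    simp only [finrank_euclideanSpace, Fintype.card_fin, smul_eq_mul]
    field_simp
  exact h.congr (ae_ne_zero_E3.mono fun x hx => by simp only [hv x hx])

theorem mul_potential_le (hχ : IsCutoff χ) (hv : ∀ x : E3, x ≠ 0 → v x = χ ‖x‖ / ‖x‖)
    {l : ℝ} (hl : 1 ≤ l) : ∀ᵐ z, l * v z ≤ v (l⁻¹ • z) := by
  filter_upwards [ae_ne_zero_E3] with z hz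
  have hl0 : 0 < l := by linarith
  have hz0 : 0 < ‖z‖ := norm_pos_iff.2 hz
  rw [hv z hz, hv _ (smul_ne_zero (inv_ne_zero hl0.ne') hz), norm_smul, norm_inv,
    Real.norm_of_nonneg hl0.le]
  have h1 : χ ‖z‖ ≤ χ (l⁻¹ * ‖z‖) :=
    hχ.mono (Set.mem_Ici.2 (by positivity)) (Set.mem_Ici.2 hz0.le)
      (mul_le_of_le_one_left hz0.le (inv_le_one_of_one_le₀ hl))
  have e : χ (l⁻¹ * ‖z‖) / (l⁻¹ * ‖z‖) = l * (χ (l⁻¹ * ‖z‖) / ‖z‖) := by field_simp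
  rw [e]
  gcongr

end Potential

section Interaction

/-- The bilinear interaction form `∫∫ v(z) g(x) h(x - z) dx dz`. -/
def interaction (v g h : E3 → ℝ) : ℝ := ∫ p : E3 × E3, v p.2 * (g p.1 * h (p.1 - p.2))

variable {v g h : E3 → ℝ} {C C' : ℝ}

theorem aestronglyMeasurable_interaction (hv : AEStronglyMeasurable v) (hg : Continuous g)
    (hh : Continuous h) :
    AEStronglyMeasurable (fun p : E3 × E3 => v p.2 * (g p.1 * h (p.1 - p.2))) :=
  hv.comp_snd.mul (by fun_prop : Continuous fun p : E3 × E3 =>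
    g p.1 * h (p.1 - p.2)).aestronglyMeasurable

theorem norm_interaction_le (hg : ∀ x, |g x| ≤ C * decayWeight x)
    (hh : ∀ x, |h x| ≤ C' * decayWeight x) (p : E3 × E3) :
    ‖v p.2 * (g p.1 * h (p.1 - p.2))‖ ≤ (C * decayWeight p.1) * (C' * |v p.2|) := by
  have hC' : 0 ≤ C' := by
    have := (abs_nonneg _).trans (hh 0)
    simpa [decayWeight] using this
  rw [norm_mul, norm_mul, Real.norm_eq_abs, Real.norm_eq_abs, Real.norm_eq_abs]
  have h1 : |h (p.1 - p.2)| ≤ C' :=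
    (hh _).trans (mul_le_of_le_one_right hC' (decayWeight_le_one _))
  have h2 := mul_le_mul (hg p.1) h1 (abs_nonneg _) ((abs_nonneg _).trans (hg p.1))
  calc _ ≤ |v p.2| * (C * decayWeight p.1 * C') := by gcongr
    _ = _ := by ring

theorem integrable_interaction_bound (hv : Integrable v) (C C' : ℝ) :
    Integrable (fun p : E3 × E3 => (C * decayWeight p.1) * (C' * |v p.2|)) :=
  (integrable_decayWeight.const_mul C).mul_prod (hv.abs.const_mul C')

theorem integrable_interaction (hv : Integrable v) (hg : Continuous g) (hh : Continuous h)
    (hgC : ∀ x, |g x| ≤ C * decayWeight x) (hhC : ∀ x, |h x| ≤ C' * decayWeight x) :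
    Integrable (fun p : E3 × E3 => v p.2 * (g p.1 * h (p.1 - p.2))) :=
  (integrable_interaction_bound hv C C').mono'
    (aestronglyMeasurable_interaction hv.aestronglyMeasurable hg hh)
    (Filter.Eventually.of_forall fun p => norm_interaction_le hgC hhC p)

theorem interaction_comm (hev : ∀ x, v (-x) = v x) (hv : Integrable v) (hg : Continuous g)
    (hh : Continuous h) (hgC : ∀ x, |g x| ≤ C * decayWeight x)
    (hhC : ∀ x, |h x| ≤ C' * decayWeight x) : interaction v g h = interaction v h g := by
  unfold interaction
  rw [Measure.volume_eq_prod, integral_prod_symm _ (integrable_interaction hv hg hh hgC hhC),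
    integral_prod_symm _ (integrable_interaction hv hh hg hhC hgC), ← integral_neg_eq_self]
  refine integral_congr_ae (Filter.Eventually.of_forall fun z => ?_)
  simp only [hev, sub_neg_eq_add]
  rw [← integral_sub_right_eq_self _ z]
  refine integral_congr_ae (Filter.Eventually.of_forall fun x => ?_)
  simp only [sub_add_cancel]
  ring

theorem interaction_eq_integral_convolution (hv : Integrable v) (hg : Continuous g)
    (hh : Continuous h) (hgC : ∀ x, |g x| ≤ C * decayWeight x)
    (hhC : ∀ x, |h x| ≤ C' * decayWeight x) :
    Integrable (fun x => convolution v h (ContinuousLinearMap.lsmul ℝ ℝ) volume x * g x) ∧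
      ∫ x, convolution v h (ContinuousLinearMap.lsmul ℝ ℝ) volume x * g x =
        interaction v g h := by
  have hi := integrable_interaction hv hg hh hgC hhC
  have e : (fun x => convolution v h (ContinuousLinearMap.lsmul ℝ ℝ) volume x * g x) =
      fun x => ∫ z, v z * (g x * h (x - z)) := by
    funext x
    simp only [convolution, ContinuousLinearMap.lsmul_apply, smul_eq_mul]
    rw [← integral_mul_const]
    congr 1
    funext z
    ring
  rw [e]
  refine ⟨hi.integral_prod_left, ?_⟩
  unfold interaction
  rw [Measure.volume_eq_prod, integral_prod _ hi]

theorem hasDerivAt_interaction {h h' : ℝ → E3 → ℝ} {s₀ ε : ℝ} (hε : 0 < ε)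
    (hev : ∀ x, v (-x) = v x) (hv : Integrable v)
    (hc : ∀ s ∈ Metric.ball s₀ ε, Continuous (h s)) (hc' : Continuous (h' s₀))
    (hd : ∀ s ∈ Metric.ball s₀ ε, ∀ x, HasDerivAt (fun s => h s x) (h' s x) s)
    (hC : ∀ s ∈ Metric.ball s₀ ε, ∀ x, |h s x| ≤ C * decayWeight x)
    (hC' : ∀ s ∈ Metric.ball s₀ ε, ∀ x, |h' s x| ≤ C' * decayWeight x) :
    HasDerivAt (fun s => interaction v (h s) (h s)) (2 * interaction v (h' s₀) (h s₀)) s₀ := by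
  have h0 : s₀ ∈ Metric.ball s₀ ε := Metric.mem_ball_self hε
  have i1 := integrable_interaction hv hc' (hc s₀ h0) (hC' s₀ h0) (hC s₀ h0)
  have i2 := integrable_interaction hv (hc s₀ h0) hc' (hC s₀ h0) (hC' s₀ h0)
  have key := (hasDerivAt_integral_of_dominated_loc_of_deriv_le
    (μ := (volume : Measure (E3 × E3)))
    (F := fun s p => v p.2 * (h s p.1 * h s (p.1 - p.2)))
    (F' := fun s p => v p.2 * (h' s p.1 * h s (p.1 - p.2)) +
      v p.2 * (h s p.1 * h' s (p.1 - p.2)))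
    (bound := fun p => (C' * decayWeight p.1) * (C * |v p.2|) +
      (C * decayWeight p.1) * (C' * |v p.2|))
    (Metric.ball_mem_nhds s₀ hε)
    (Filter.eventually_of_mem (Metric.ball_mem_nhds s₀ hε) fun s hs =>
      aestronglyMeasurable_interaction hv.aestronglyMeasurable (hc s hs) (hc s hs))
    (integrable_interaction hv (hc s₀ h0) (hc s₀ h0) (hC s₀ h0) (hC s₀ h0))
    (i1.add i2).aestronglyMeasurable
    (Filter.Eventually.of_forall fun p s hs => (norm_add_le _ _).trans
      (add_le_add (norm_interaction_le (hC' s hs) (hC s hs) p)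
        (norm_interaction_le (hC s hs) (hC' s hs) p)))
    ((integrable_interaction_bound hv C' C).add (integrable_interaction_bound hv C C'))
    (Filter.Eventually.of_forall fun p s hs =>
      (((hd s hs p.1).mul (hd s hs (p.1 - p.2))).const_mul (v p.2)).congr_deriv (by ring))).2
  refine key.congr_deriv ?_
  rw [integral_add i1 i2, two_mul]
  exact congrArg _ (interaction_comm hev hv (hc s₀ h0) hc' (hC s₀ h0) (hC' s₀ h0))

/-- Subcriticality of the potential under dilations, integrated against a density. -/
theorem mul_interaction_le_interaction_dilation {χ : ℝ → ℝ} (hχ : IsCutoff χ)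
    (hχv : ∀ x : E3, x ≠ 0 → v x = χ ‖x‖ / ‖x‖) (hg : Continuous g) (hg0 : ∀ x, 0 ≤ g x)
    (hgC : ∀ x, |g x| ≤ C * decayWeight x) {l : ℝ} (hl : 1 ≤ l) :
    interaction v g g ≤ l ^ 5 * interaction v (fun x => g (l • x)) (fun x => g (l • x)) := by
  have hl0 : 0 < l := by linarith
  have hv := integrable_potential hχ hχv
  have hvl : Integrable (fun z => v (l⁻¹ • z)) := hv.comp_smul (inv_ne_zero hl0.ne')
  have e1 : ∫ p : E3 × E3, v (l⁻¹ • p.2) * (g p.1 * g (p.1 - p.2)) =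
      l ^ 6 * interaction v (fun x => g (l • x)) (fun x => g (l • x)) := by
    have h := Measure.integral_comp_smul ((volume : Measure E3).prod (volume : Measure E3))
      (fun p : E3 × E3 => v (l⁻¹ • p.2) * (g p.1 * g (p.1 - p.2))) l
    have hr : Module.finrank ℝ (E3 × E3) = 6 := by simp
    simp only [Prod.smul_fst, Prod.smul_snd, inv_smul_smul₀ hl0.ne', ← smul_sub, hr] at h
    rw [abs_of_nonneg (by positivity), smul_eq_mul] at h
    unfold interaction
    rw [Measure.volume_eq_prod, h]
    field_simp
  have e2 : l * interaction v g g ≤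
      ∫ p : E3 × E3, v (l⁻¹ • p.2) * (g p.1 * g (p.1 - p.2)) := by
    unfold interaction
    rw [← integral_const_mul]
    refine integral_mono_ae ((integrable_interaction hv hg hg hgC hgC).const_mul l)
      (integrable_interaction hvl hg hg hgC hgC) ?_
    have := (Measure.quasiMeasurePreserving_snd (μ := (volume : Measure E3))
      (ν := (volume : Measure E3))).ae (mul_potential_le hχ hχv hl)
    rw [Measure.volume_eq_prod]
    filter_upwards [this] with p hp
    rw [← mul_assoc]
    exact mul_le_mul_of_nonneg_right hp (mul_nonneg (hg0 _) (hg0 _))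
  rw [e1] at e2
  refine le_of_mul_le_mul_left (e2.trans_eq ?_) hl0
  ring

/-- A differentiable function which is minimal at the left endpoint of a half-line has nonnegative
derivative there. -/
theorem HasDerivAt.nonneg_of_forall_le {F : ℝ → ℝ} {F' a : ℝ} (hF : HasDerivAt F F' a)
    (h : ∀ s, a ≤ s → F a ≤ F s) : 0 ≤ F' := by
  have h1 := (hasDerivWithinAt_iff_tendsto_slope' (by simp)).1
    (hF.hasDerivWithinAt (s := Set.Ioi a))
  refine ge_of_tendsto h1 (eventually_mem_nhdsWithin.mono fun s hs => ?_)
  rw [slope_def_field]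
  exact div_nonneg (sub_nonneg.2 (h s (Set.mem_Ioi.1 hs).le)) (sub_nonneg.2 (Set.mem_Ioi.1 hs).le)

theorem decayWeight_smul_le {l : ℝ} (hl : 1 / 2 < l) (x : E3) :
    decayWeight (l • x) ≤ 16 * decayWeight x := by
  unfold decayWeight
  rw [norm_smul, Real.norm_of_nonneg (by linarith), ← div_eq_mul_inv, le_div_iff₀ (by positivity),
    inv_mul_le_iff₀ (by have := norm_nonneg x; positivity)]
  have h : 1 + ‖x‖ ≤ 2 * (1 + l * ‖x‖) := by nlinarith [norm_nonneg x]
  calc (1 + ‖x‖) ^ 4 ≤ (2 * (1 + l * ‖x‖)) ^ 4 := by gcongr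
    _ = _ := by ring

/-- The virial inequality for the interaction energy: `5 Q + 2 ∫ W x·∇q ≥ 0`. -/
theorem virial_interaction_nonneg {χ : ℝ → ℝ} (hχ : IsCutoff χ)
    (hχv : ∀ x : E3, x ≠ 0 → v x = χ ‖x‖ / ‖x‖) (hg : ContDiff ℝ 1 g) (hg0 : ∀ x, 0 ≤ g x)
    (hgC : ∀ x, |g x| ≤ C * decayWeight x)
    (hgC' : ∀ x, |fderiv ℝ g x x| ≤ C' * decayWeight x) :
    0 ≤ 5 * interaction v g g + 2 * interaction v (fun x => fderiv ℝ g x x) g := by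
  have hC0 : 0 ≤ C := by
    have := (abs_nonneg _).trans (hgC 0)
    simpa [decayWeight] using this
  have hC0' : 0 ≤ C' := by
    have := (abs_nonneg _).trans (hgC' 0)
    simpa [decayWeight] using this
  have hl : ∀ s ∈ Metric.ball (1 : ℝ) (1 / 2), 1 / 2 < s := fun s hs => by
    rw [Metric.mem_ball, Real.dist_eq, abs_lt] at hs
    linarith
  have hder := hasDerivAt_interaction (v := v) (h := fun s x => g (s • x))
    (h' := fun s x => fderiv ℝ g (s • x) x) (s₀ := 1) (ε := 1 / 2)
    (C := C * 16) (C' := C' * 32) (by norm_num) (potential_even hχv)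
    (integrable_potential hχ hχv)
    (fun s _ => hg.continuous.comp (continuous_const_smul s))
    (by
      have := hg.continuous_fderiv (by simp)
      fun_prop)
    (fun s _ x => by
      have h1 : HasDerivAt (fun s : ℝ => s • x) x s := by
        simpa using (hasDerivAt_id s).smul_const x
      exact (hg.differentiable (by simp) (s • x)).hasFDerivAt.comp_hasDerivAt s h1)
    (fun s hs x => (hgC _).trans (by
      rw [mul_assoc]
      exact mul_le_mul_of_nonneg_left (decayWeight_smul_le (hl s hs) x) hC0))
    (fun s hs x => by
      have h1 := hl s hs
      have h2 := (hgC' (s • x)).trans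
        (mul_le_mul_of_nonneg_left (decayWeight_smul_le (hl s hs) x) hC0')
      rw [map_smul, smul_eq_mul, abs_mul, abs_of_pos (by linarith)] at h2
      nlinarith [abs_nonneg (fderiv ℝ g (s • x) x)])
  have hF := ((hasDerivAt_pow 5 (1 : ℝ)).mul hder).nonneg_of_forall_le (fun s hs => by
    simpa using mul_interaction_le_interaction_dilation hχ hχv hg.continuous hg0 hgC hs)
  simpa using hF

theorem interaction_nonneg (hv : ∀ᵐ x, 0 ≤ v x) (hg : ∀ x, 0 ≤ g x) (hh : ∀ x, 0 ≤ h x) :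
    0 ≤ interaction v g h := by
  refine integral_nonneg_of_ae ?_
  have := (Measure.quasiMeasurePreserving_snd (μ := (volume : Measure E3))
    (ν := (volume : Measure E3))).ae hv
  rw [Measure.volume_eq_prod]
  filter_upwards [this] with p hp
  exact mul_nonneg hp (mul_nonneg (hg _) (hh _))

end Interaction

theorem interaction_self_le {v g : E3 → ℝ} {C : ℝ} (hv0 : ∀ᵐ x, 0 ≤ v x) (hv : Integrable v)
    (hg : Continuous g) (hgC : ∀ x, |g x| ≤ C * decayWeight x) :
    interaction v g g ≤ (∫ z, v z) * ∫ x, g x ^ 2 := by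
  have hC0 : 0 ≤ C := by
    have := (abs_nonneg _).trans (hgC 0)
    simpa [decayWeight] using this
  have hg2 : Integrable (fun x => g x ^ 2) := by
    refine (integrable_decayWeight.const_mul (C * C)).mono'
      (hg.pow 2).aestronglyMeasurable (Filter.Eventually.of_forall fun x => ?_)
    rw [norm_pow, Real.norm_eq_abs, sq]
    have h1 : |g x| ≤ C := (hgC x).trans (mul_le_of_le_one_right hC0 (decayWeight_le_one x))
    calc |g x| * |g x| ≤ C * (C * decayWeight x) := by gcongr; exact hgC x
      _ = _ := by ring
  have i1 : Integrable (fun p : E3 × E3 => g p.1 ^ 2 * v p.2) := hg2.mul_prod hv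
  have i2 : Integrable (fun p : E3 × E3 => v p.2 * g (p.1 - p.2) ^ 2) :=
    hv.convolution_integrand (ContinuousLinearMap.lsmul ℝ ℝ) hg2
  have e1 : ∫ p : E3 × E3, g p.1 ^ 2 * v p.2 = (∫ z, v z) * ∫ x, g x ^ 2 := by
    rw [Measure.volume_eq_prod, integral_prod_mul (fun x => g x ^ 2) v, mul_comm]
  have e2 : ∫ p : E3 × E3, v p.2 * g (p.1 - p.2) ^ 2 = (∫ z, v z) * ∫ x, g x ^ 2 := by
    rw [Measure.volume_eq_prod, integral_prod_symm _ i2, ← integral_mul_const]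
    congr 1
    funext z
    change ∫ x, v z * g (x - z) ^ 2 = _
    rw [integral_const_mul, integral_sub_right_eq_self (fun x => g x ^ 2) z]
  have key : interaction v g g ≤
      ∫ p : E3 × E3, (1 / 2) * (g p.1 ^ 2 * v p.2 + v p.2 * g (p.1 - p.2) ^ 2) := by
    refine integral_mono_ae (integrable_interaction hv hg hg hgC hgC)
      ((i1.add i2).const_mul (1 / 2)) ?_
    have := (Measure.quasiMeasurePreserving_snd (μ := (volume : Measure E3))
      (ν := (volume : Measure E3))).ae hv0
    rw [Measure.volume_eq_prod]
    filter_upwards [this] with p hp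
    nlinarith [mul_nonneg hp (sq_nonneg (g p.1 - g (p.1 - p.2)))]
  rw [integral_const_mul, integral_add i1 i2, e1, e2] at key
  linarith

theorem IsHartreeSolution.locSchwartz {v : E3 → ℝ} {φ : ℝ → E3 → ℂ}
    (hφ : IsHartreeSolution v φ) : LocSchwartz (fun p => φ p.1 p.2) where
  smooth := hφ.smooth
  decay n k T := by
    obtain ⟨C, hC⟩ := hφ.decay 0 n T
    obtain ⟨C', hC'⟩ := hφ.decay k n T
    refine ⟨2 ^ (k - 1) * (C + C'), fun t x ht => ?_⟩
    have h := add_pow_le zero_le_one (norm_nonneg x) k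
    refine (mul_le_mul_of_nonneg_right h (norm_nonneg _)).trans ?_
    rw [mul_assoc]
    gcongr
    have h1 := hC t x ht
    have h2 := hC' t x ht
    rw [pow_zero] at h1
    rw [one_pow, add_mul]
    exact add_le_add h1 h2

theorem IsHartreeSolution.equation {v : E3 → ℝ} {φ : ℝ → E3 → ℂ}
    (hφ : IsHartreeSolution v φ) (p : ℝ × E3) :
    Complex.I * dirD timeDir (fun p => φ p.1 p.2) p +
      (∑ j, dirD (spaceDir j) (dirD (spaceDir j) (fun p => φ p.1 p.2)) p) -
      (hartreeW v (φ p.1) p.2 : ℂ) * φ p.1 p.2 = 0 := by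
  obtain ⟨t, x⟩ := p
  have hf := hφ.locSchwartz
  have h := hφ.eqn t x
  have e1 : deriv (fun s => φ s x) t = dirD timeDir (fun p => φ p.1 p.2) (t, x) :=
    (hasDerivAt_time hf.differentiable t x).deriv
  have e2 : lapC (φ t) x =
      ∑ j, dirD (spaceDir j) (dirD (spaceDir j) (fun p => φ p.1 p.2)) (t, x) := by
    unfold lapC
    refine Finset.sum_congr rfl fun j _ => ?_
    rw [← fderiv_space (hf.dirD _).differentiable]
    congr 2
    funext y
    exact fderiv_space hf.differentiable t y j
  rw [e1, e2] at h
  exact h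

theorem IsHartreeSolution.conj_equation {v : E3 → ℝ} {φ : ℝ → E3 → ℂ}
    (hφ : IsHartreeSolution v φ) (p : ℝ × E3) :
    -Complex.I * dirD timeDir (fun p => starRingEnd ℂ (φ p.1 p.2)) p +
      (∑ j, dirD (spaceDir j) (dirD (spaceDir j) (fun p => starRingEnd ℂ (φ p.1 p.2))) p) -
      (hartreeW v (φ p.1) p.2 : ℂ) * starRingEnd ℂ (φ p.1 p.2) = 0 := by
  have hf := hφ.locSchwartz
  have h1 : ∀ w, dirD w (fun p => starRingEnd ℂ (φ p.1 p.2)) =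
      fun p => starRingEnd ℂ (dirD w (fun p => φ p.1 p.2) p) := fun w =>
    funext fun p => dirD_conj hf.differentiable w p
  simp only [h1, dirD_conj (hf.dirD _).differentiable]
  have h := congrArg (starRingEnd ℂ) (hφ.equation p)
  simpa using h

/-- If a rapidly decaying function is real valued, so are its directional derivatives. -/
theorem LocSchwartz.dirD_ofReal {F : ℝ × E3 → ℂ} (hF : LocSchwartz F) {q : ℝ × E3 → ℝ}
    (h : ∀ p, F p = (q p : ℂ)) (w p : ℝ × E3) :
    _root_.dirD w F p = ((fderiv ℝ q p w : ℝ) : ℂ) := by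
  have hq : q = fun p => Complex.reCLM (F p) := by
    funext p
    simp [h]
  have hd : Differentiable ℝ q := hq ▸ Complex.reCLM.differentiable.comp hF.differentiable
  have e : F = fun p => Complex.ofRealCLM (q p) := funext h
  have h1 := (Complex.ofRealCLM.hasFDerivAt.comp p (hd p).hasFDerivAt).fderiv
  unfold _root_.dirD
  rw [e]
  exact congrArg (fun L => L w) h1

theorem LocSchwartz.contDiff_of_eq_ofReal {F : ℝ × E3 → ℂ} (hF : LocSchwartz F)
    {q : ℝ × E3 → ℝ} (h : ∀ p, F p = (q p : ℂ)) : ContDiff ℝ (⊤ : ℕ∞) q := by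
  have hq : q = fun p => Complex.reCLM (F p) := by
    funext p
    simp [h]
  exact hq ▸ Complex.reCLM.contDiff.comp hF.smooth

theorem sum_coord_smul_single (x : E3) :
    ∑ j, x j • (EuclideanSpace.single j 1 : E3) = x := by
  ext i
  simp [Pi.single_apply]

theorem norm_sq_le_sum_norm_sq (L : E3 →L[ℝ] ℂ) :
    ‖L‖ ^ 2 ≤ ∑ j, ‖L (EuclideanSpace.single j 1)‖ ^ 2 := by
  have h0 : 0 ≤ ∑ j, ‖L (EuclideanSpace.single j 1)‖ ^ 2 := by positivity
  have h : ‖L‖ ≤ √(∑ j, ‖L (EuclideanSpace.single j 1)‖ ^ 2) := by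
    refine L.opNorm_le_bound (Real.sqrt_nonneg _) fun x => ?_
    have h1 : ‖L x‖ ≤ ∑ j, ‖L (EuclideanSpace.single j 1)‖ * ‖x j‖ := by
      conv_lhs => rw [← sum_coord_smul_single x, map_sum]
      refine (norm_sum_le _ _).trans (Finset.sum_le_sum fun j _ => ?_)
      rw [map_smul, norm_smul, mul_comm]
    refine h1.trans ?_
    rw [EuclideanSpace.norm_eq]
    exact Real.sum_mul_le_sqrt_mul_sqrt _ _ _
  calc ‖L‖ ^ 2 ≤ √(∑ j, ‖L (EuclideanSpace.single j 1)‖ ^ 2) ^ 2 := by gcongr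
    _ = _ := Real.sq_sqrt h0

/-- The kinetic part of the pseudoconformal energy. -/
def pseudoKinetic (φ : ℝ → E3 → ℂ) (t : ℝ) : ℝ :=
  ∫ x : E3, ∑ j : Fin 3, ‖t * dirD (spaceDir j) (fun p => φ p.1 p.2) (t, x) -
    Complex.I / 2 * (coordC j (t, x) * φ t x)‖ ^ 2

/-- The interaction energy of a Hartree solution. -/
def hartreeEnergy (v : E3 → ℝ) (φ : ℝ → E3 → ℂ) (t : ℝ) : ℝ :=
  interaction v (fun x => ‖φ t x‖ ^ 2) (fun x => ‖φ t x‖ ^ 2)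

theorem integral_norm_sq_eq {v : E3 → ℝ} {φ : ℝ → E3 → ℂ} (hφ : IsHartreeSolution v φ) (t s : ℝ) :
    ∫ x, ‖φ t x‖ ^ 2 = ∫ x, ‖φ s x‖ ^ 2 := by
  have hf := hφ.locSchwartz
  have h1 : ∀ t, HasDerivAt
      (fun s => ∫ x, (fun p : ℝ × E3 => φ p.1 p.2 * starRingEnd ℂ (φ p.1 p.2)) (s, x)) 0 t := by
    intro t
    have h := (hf.mul hf.conj).hasDerivAt_integral t
    rwa [integral_dirD_time_density hf hf.conj hφ.equation hφ.conj_equation t] at h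
  have h2 := is_const_of_deriv_eq_zero (fun t => (h1 t).differentiableAt) (fun t => (h1 t).deriv) t s
  have e : ∀ t, ∫ x, (fun p : ℝ × E3 => φ p.1 p.2 * starRingEnd ℂ (φ p.1 p.2)) (t, x) =
      ((∫ x, ‖φ t x‖ ^ 2 : ℝ) : ℂ) := by
    intro t
    rw [← integral_complex_ofReal]
    refine integral_congr_ae (Filter.Eventually.of_forall fun x => ?_)
    simp [Complex.mul_conj']
  rw [e, e] at h2
  exact_mod_cast h2

theorem hasDerivAt_time_real {q : ℝ × E3 → ℝ} (hq : Differentiable ℝ q) (t : ℝ) (x : E3) :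
    HasDerivAt (fun s => q (s, x)) (fderiv ℝ q (t, x) timeDir) t :=
  (hq (t, x)).hasFDerivAt.comp_hasDerivAt t ((hasDerivAt_id t).prodMk (hasDerivAt_const t x))

theorem hasDerivAt_pseudoconformal {v : E3 → ℝ} {χ : ℝ → ℝ} {φ : ℝ → E3 → ℂ} (hχ : IsCutoff χ)
    (hχv : ∀ x : E3, x ≠ 0 → v x = χ ‖x‖ / ‖x‖) (hφ : IsHartreeSolution v φ) (t : ℝ) (ht : 0 < t) :
    ∃ E', HasDerivAt (fun s => pseudoKinetic φ s + s ^ 2 / 2 * hartreeEnergy v φ s) E' t ∧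
      E' ≤ t / 2 * hartreeEnergy v φ t := by
  have hv := integrable_potential hχ hχv
  set f : ℝ × E3 → ℂ := fun p => φ p.1 p.2 with hfdef
  set c : ℝ × E3 → ℂ := fun p => starRingEnd ℂ (φ p.1 p.2) with hcdef
  have hf : LocSchwartz f := hφ.locSchwartz
  have hc : LocSchwartz c := hf.conj
  set F : ℝ × E3 → ℂ := fun p => f p * c p with hFdef
  have hF : LocSchwartz F := hf.mul hc
  set q : ℝ × E3 → ℝ := fun p => ‖φ p.1 p.2‖ ^ 2 with hqdef
  have hFq : ∀ p, F p = (q p : ℂ) := fun p => by simp [F, f, c, q, Complex.mul_conj']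
  have hq : ContDiff ℝ (⊤ : ℕ∞) q := hF.contDiff_of_eq_ofReal hFq
  have hq1 : Differentiable ℝ q := hq.differentiable (by simp)
  have hq' : Continuous (fderiv ℝ q) := hq.continuous_fderiv (by simp)
  have hqt : ∀ s, ContDiff ℝ (⊤ : ℕ∞) (fun x => q (s, x)) := fun s =>
    hq.comp (contDiff_const.prodMk contDiff_id)
  have dq : ∀ s x, HasDerivAt (fun s => q (s, x)) (fderiv ℝ q (s, x) timeDir) s := fun s x =>
    hasDerivAt_time_real hq1 s x
  obtain ⟨C, -, hC⟩ := hF.exists_bound (|t| + 1)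
  obtain ⟨C₁, -, hC₁⟩ := (hF.dirD timeDir).exists_bound (|t| + 1)
  have hX : LocSchwartz (fun p => ∑ j, coordC j p * dirD (spaceDir j) F p) :=
    LocSchwartz.sum fun j => (hF.dirD _).coord_mul j
  obtain ⟨C₂, -, hC₂⟩ := hX.exists_bound (|t| + 1)
  have hqC : ∀ s, |s| ≤ |t| + 1 → ∀ x, |q (s, x)| ≤ C * decayWeight x := fun s hs x => by
    have := hC s x hs
    rwa [hFq, Complex.norm_real] at this
  have hqC₁ : ∀ s, |s| ≤ |t| + 1 → ∀ x, |fderiv ℝ q (s, x) timeDir| ≤ C₁ * decayWeight x :=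
    fun s hs x => by
      have := hC₁ s x hs
      rwa [hF.dirD_ofReal hFq, Complex.norm_real] at this
  have hXr : ∀ x : E3, ∑ j, coordC j (t, x) * dirD (spaceDir j) F (t, x) =
      ((fderiv ℝ (fun y => q (t, y)) x x : ℝ) : ℂ) := by
    intro x
    have h1 : fderiv ℝ (fun y => q (t, y)) x x = ∑ j, x j * fderiv ℝ q (t, x) (spaceDir j) := by
      have h2 : HasFDerivAt (fun y => q (t, y))
          (fderiv ℝ q (t, x) ∘L ContinuousLinearMap.inr ℝ ℝ E3) x :=
        (hq1 (t, x)).hasFDerivAt.comp x (hasFDerivAt_prodMk_right t x)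
      rw [h2.fderiv]
      conv_lhs => rw [← sum_coord_smul_single x, map_sum]
      refine Finset.sum_congr rfl fun j _ => ?_
      rw [map_smul, sum_coord_smul_single]
      rfl
    rw [h1]
    push_cast
    refine Finset.sum_congr rfl fun j _ => ?_
    rw [hF.dirD_ofReal hFq]
    rfl
  have ht1 : |t| ≤ |t| + 1 := by linarith
  have hqC₂ : ∀ x, |fderiv ℝ (fun y => q (t, y)) x x| ≤ C₂ * decayWeight x := fun x => by
    have := hC₂ t x ht1
    rwa [hXr, Complex.norm_real] at this
  have hball : ∀ s ∈ Metric.ball t 1, |s| ≤ |t| + 1 := fun s hs => by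
    rw [Metric.mem_ball, Real.dist_eq] at hs
    have := abs_sub_abs_le_abs_sub s t
    linarith
  set Q : ℝ := hartreeEnergy v φ t with hQ
  set a : ℝ := interaction v (fun x => fderiv ℝ q (t, x) timeDir) (fun x => q (t, x)) with ha
  set Y : ℝ := interaction v (fun x => fderiv ℝ (fun y => q (t, y)) x x) (fun x => q (t, x)) with hY
  have cq : ∀ s, Continuous fun x => q (s, x) := fun s => (hqt s).continuous
  have cqt : Continuous fun x => fderiv ℝ q (t, x) timeDir := by fun_prop
  have cqx : Continuous fun x => fderiv ℝ (fun y => q (t, y)) x x := by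
    have := (hqt t).continuous_fderiv (by simp)
    fun_prop
  have dQ : HasDerivAt (hartreeEnergy v φ) (2 * a) t :=
    hasDerivAt_interaction (h := fun s x => q (s, x))
      (h' := fun s x => fderiv ℝ q (s, x) timeDir) one_pos (potential_even hχv) hv
      (fun s _ => cq s) cqt
      (fun s _ x => dq s x)
      (fun s hs => hqC s (hball s hs)) (fun s hs => hqC₁ s (hball s hs))
  have vir : 0 ≤ 5 * Q + 2 * Y :=
    virial_interaction_nonneg hχ hχv ((hqt t).of_le (by exact_mod_cast le_top))
      (fun x => sq_nonneg _) (hqC t ht1) hqC₂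
  set W : ℝ × E3 → ℂ := fun p => (hartreeW v (φ p.1) p.2 : ℂ) with hW
  have LA : LocSchwartz (fun p => ∑ j, dirD (spaceDir j) f p * dirD (spaceDir j) c p) :=
    .sum fun j => (hf.dirD _).mul (hc.dirD _)
  have LM : LocSchwartz (fun p => ∑ j, coordC j p * (coordC j p * (f p * c p))) :=
    .sum fun j => ((hf.mul hc).coord_mul j).coord_mul j
  have LS : LocSchwartz (fun p => ∑ j, coordC j p * (c p * dirD (spaceDir j) f p -
      f p * dirD (spaceDir j) c p)) :=
    .sum fun j => ((hc.mul (hf.dirD _)).sub (hf.mul (hc.dirD _))).coord_mul j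
  have dA := LA.hasDerivAt_integral t
  have dM := LM.hasDerivAt_integral t
  have dS := LS.hasDerivAt_integral t
  rw [integral_dirD_time_gradient (W := W) hf hc hφ.equation hφ.conj_equation t] at dA
  rw [integral_dirD_time_moment (W := W) hf hc hφ.equation hφ.conj_equation t,
    integral_const_mul] at dM
  rw [integral_dirD_time_virial (W := W) hf hc hφ.equation hφ.conj_equation t] at dS
  obtain ⟨-, ia⟩ := interaction_eq_integral_convolution hv cqt (cq t) (hqC₁ t ht1) (hqC t ht1)
  obtain ⟨iQ, iQ'⟩ :=
    interaction_eq_integral_convolution hv (cq t) (cq t) (hqC t ht1) (hqC t ht1)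
  obtain ⟨iY, iY'⟩ := interaction_eq_integral_convolution hv cqx (cq t) hqC₂ (hqC t ht1)
  change Integrable (fun x => hartreeW v (φ t) x * q (t, x)) at iQ
  change Integrable (fun x => hartreeW v (φ t) x * fderiv ℝ (fun y => q (t, y)) x x) at iY
  have eA : ∫ x, -(W (t, x) * dirD timeDir (fun p => f p * c p) (t, x)) = -(a : ℂ) := by
    rw [ha, ← ia, integral_neg, ← integral_complex_ofReal]
    congr 2
    funext x
    rw [hF.dirD_ofReal hFq, Complex.ofReal_mul]
    rfl
  set A : ℝ → ℂ := fun s => ∫ x, (fun p => ∑ j, dirD (spaceDir j) f p * dirD (spaceDir j) c p)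
    (s, x) with hA
  set S : ℝ → ℂ := fun s => ∫ x, (fun p => ∑ j, coordC j p * (c p * dirD (spaceDir j) f p -
    f p * dirD (spaceDir j) c p)) (s, x) with hS
  set M : ℝ → ℂ := fun s => ∫ x, (fun p => ∑ j, coordC j p * (coordC j p * (f p * c p)))
    (s, x) with hM
  rw [eA] at dA
  have eS : ∫ x, (4 * Complex.I * (∑ j, dirD (spaceDir j) f (t, x) * dirD (spaceDir j) c (t, x))
        + Complex.I * (W (t, x) * (6 * (f (t, x) * c (t, x)) +
          2 * ∑ j, coordC j (t, x) * dirD (spaceDir j) (fun p => f p * c p) (t, x)))) =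
      4 * Complex.I * A t + Complex.I * (6 * Q + 2 * Y) := by
    have e1 : ∀ x, W (t, x) * (6 * (f (t, x) * c (t, x)) +
          2 * ∑ j, coordC j (t, x) * dirD (spaceDir j) (fun p => f p * c p) (t, x)) =
        ((6 * (hartreeW v (φ t) x * q (t, x)) + 2 * (hartreeW v (φ t) x *
          fderiv ℝ (fun y => q (t, y)) x x) : ℝ) : ℂ) := by
      intro x
      rw [hXr x, show f (t, x) * c (t, x) = (q (t, x) : ℂ) from hFq (t, x)]
      push_cast
      ring
    simp only [e1]
    have i0 : Integrable (fun x => 6 * (hartreeW v (φ t) x * q (t, x)) +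
        2 * (hartreeW v (φ t) x * fderiv ℝ (fun y => q (t, y)) x x)) :=
      (iQ.const_mul 6).add (iY.const_mul 2)
    have i1 : ∫ x, (6 * (hartreeW v (φ t) x * q (t, x)) +
        2 * (hartreeW v (φ t) x * fderiv ℝ (fun y => q (t, y)) x x)) = 6 * Q + 2 * Y := by
      rw [integral_add (iQ.const_mul 6) (iY.const_mul 2), integral_const_mul, integral_const_mul]
      exact congrArg₂ (fun a b => 6 * a + 2 * b) iQ' iY'
    have i2 : Integrable (fun x => ((6 * (hartreeW v (φ t) x * q (t, x)) +
        2 * (hartreeW v (φ t) x * fderiv ℝ (fun y => q (t, y)) x x) : ℝ) : ℂ)) := i0.ofReal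
    rw [integral_add ((LA.integrable t).const_mul _) (i2.const_mul _),
      integral_const_mul, integral_const_mul, integral_complex_ofReal, i1]
    push_cast
    rfl
  rw [eS] at dS
  have hK : ∀ s, pseudoKinetic φ s =
      ((s : ℂ) ^ 2 * A s + Complex.I / 2 * s * S s + 1 / 4 * M s).re := by
    intro s
    rw [← Complex.ofReal_re (pseudoKinetic φ s), pseudoKinetic, ← integral_complex_ofReal]
    congr 1
    rw [hA, hS, hM, ← integral_const_mul, ← integral_const_mul, ← integral_const_mul,
      ← integral_add, ← integral_add]
    · congr 1
      funext x
      simp only [Finset.mul_sum, ← Finset.sum_add_distrib]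
      push_cast
      refine Finset.sum_congr rfl fun j _ => ?_
      have e1 : dirD (spaceDir j) c (s, x) = starRingEnd ℂ (dirD (spaceDir j) f (s, x)) :=
        dirD_conj hf.differentiable _ _
      rw [← Complex.mul_conj', e1]
      simp only [map_sub, map_mul, map_div₀, Complex.conj_I, Complex.conj_ofReal, coordC, f, c,
        map_ofNat]
      ring_nf
      simp only [Complex.I_sq]
      ring
    · exact ((LA.integrable s).const_mul _).add ((LS.integrable s).const_mul _)
    · exact (LM.integrable s).const_mul _
    · exact (LA.integrable s).const_mul _
    · exact (LS.integrable s).const_mul _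
  have dt : HasDerivAt (fun s : ℝ => (s : ℂ)) 1 t := (hasDerivAt_id t).ofReal_comp
  have dK := Complex.reCLM.hasFDerivAt.comp_hasDerivAt t
    ((((dt.pow 2).mul dA).add ((dt.const_mul (Complex.I / 2)).mul dS)).add
      (dM.const_mul (1 / 4)))
  have dK' := dK.congr_of_eventuallyEq (Filter.Eventually.of_forall hK)
  refine ⟨_, dK'.add (((hasDerivAt_pow 2 t).div_const 2).mul dQ), ?_⟩
  have e : (((2 : ℕ) : ℂ) * (t : ℂ) ^ (2 - 1) * 1 * A t + (t : ℂ) ^ 2 * -(a : ℂ) +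
      (Complex.I / 2 * 1 * S t + Complex.I / 2 * t *
        (4 * Complex.I * A t + Complex.I * (6 * Q + 2 * Y))) +
      1 / 4 * (-2 * Complex.I * S t)) = ((-t ^ 2 * a - t * (3 * Q + Y) : ℝ) : ℂ) := by
    push_cast
    ring_nf
    simp only [Complex.I_sq]
    ring
  refine (congrArg₂ (· + ·) (congrArg Complex.reCLM e) rfl).trans_le ?_
  simp only [Complex.reCLM_apply, Complex.ofReal_re]
  norm_num
  rw [← hQ]
  nlinarith [mul_nonneg ht.le vir]

theorem continuous_norm_sq_decay {φ : ℝ → E3 → ℂ} (hf : LocSchwartz (fun p => φ p.1 p.2)) (t : ℝ) :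
    Continuous (fun x => ‖φ t x‖ ^ 2) ∧ Integrable (fun x => ‖φ t x‖ ^ 2) ∧
      ∃ C, ∀ x, |‖φ t x‖ ^ 2| ≤ C * decayWeight x := by
  obtain ⟨C, -, hC⟩ := (hf.mul hf.conj).exists_bound |t|
  have e : ∀ x, φ t x * starRingEnd ℂ (φ t x) = ((‖φ t x‖ ^ 2 : ℝ) : ℂ) := fun x => by
    simp [Complex.mul_conj']
  have h1 : Continuous (fun x => φ t x) := hf.continuous.comp (Continuous.prodMk_right t)
  have h2 : ∀ x, |‖φ t x‖ ^ 2| ≤ C * decayWeight x := fun x => by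
    have := hC t x le_rfl
    simp only [e] at this
    rwa [Complex.norm_real] at this
  exact ⟨by fun_prop, (integrable_decayWeight.const_mul C).mono'
    (by fun_prop : Continuous fun x => ‖φ t x‖ ^ 2).aestronglyMeasurable
    (Filter.Eventually.of_forall h2), C, h2⟩

theorem pseudoKinetic_nonneg (φ : ℝ → E3 → ℂ) (t : ℝ) : 0 ≤ pseudoKinetic φ t :=
  integral_nonneg fun _ => by positivity

/-- Decay of the density in terms of the pseudoconformal energy. -/
theorem integral_norm_pow_four_le_pseudoKinetic {v : E3 → ℝ} {φ : ℝ → E3 → ℂ}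
    (hφ : IsHartreeSolution v φ) : ∃ C, 0 ≤ C ∧ ∀ t, 0 < t →
      ∫ x, (‖φ t x‖ ^ 2) ^ 2 ≤ C * (√(pseudoKinetic φ t) / t) ^ 3 := by
  obtain ⟨C, hC, hGN⟩ := integral_norm_pow_four_le
  have hf := hφ.locSchwartz
  refine ⟨C * √(∫ x, ‖φ 0 x‖ ^ 2), by positivity, fun t ht => ?_⟩
  have htc : (t : ℂ) ≠ 0 := by exact_mod_cast ht.ne'
  set e : E3 → ℂ := fun x => Complex.exp (-Complex.I / (4 * t) * ((‖x‖ ^ 2 : ℝ) : ℂ)) with he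
  have hes : ContDiff ℝ 1 e := by
    have h1 : ContDiff ℝ 1 (fun x : E3 => ((‖x‖ ^ 2 : ℝ) : ℂ)) :=
      Complex.ofRealCLM.contDiff.comp (contDiff_norm_sq ℝ)
    exact (contDiff_const.mul h1).cexp
  have hen : ∀ x, ‖e x‖ = 1 := fun x => by
    have h1 : -Complex.I / (4 * t) * ((‖x‖ ^ 2 : ℝ) : ℂ) =
        ((-(‖x‖ ^ 2) / (4 * t) : ℝ) : ℂ) * Complex.I := by
      push_cast
      ring
    simp only [he]
    rw [h1, Complex.norm_exp_ofReal_mul_I]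
  have hφt : ContDiff ℝ 1 (φ t) :=
    (hf.smooth.of_le (by exact_mod_cast le_top)).comp (contDiff_const.prodMk contDiff_id)
  have hus : ContDiff ℝ 1 (fun x => e x * φ t x) := hes.mul hφt
  have hun : ∀ x, ‖e x * φ t x‖ = ‖φ t x‖ := fun x => by rw [norm_mul, hen, one_mul]
  have hde : ∀ x (j : Fin 3), fderiv ℝ e x (EuclideanSpace.single j 1) =
      e x * (-Complex.I / (2 * t) * coordC j (t, x)) := by
    intro x j
    have h1 : HasFDerivAt (fun x : E3 => ((‖x‖ ^ 2 : ℝ) : ℂ))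
        (Complex.ofRealCLM ∘L (2 • innerSL ℝ x)) x :=
      Complex.ofRealCLM.hasFDerivAt.comp x (hasStrictFDerivAt_norm_sq x).hasFDerivAt
    have h2 := (h1.const_mul (-Complex.I / (4 * t))).cexp
    rw [h2.fderiv]
    simp [coordC, EuclideanSpace.inner_single_right, he]
    field_simp
    ring
  have hdu : ∀ x (j : Fin 3), fderiv ℝ (fun x => e x * φ t x) x (EuclideanSpace.single j 1) =
      e x * ((t : ℂ)⁻¹ * (t * dirD (spaceDir j) (fun p => φ p.1 p.2) (t, x) -
        Complex.I / 2 * (coordC j (t, x) * φ t x))) := by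
    intro x j
    rw [fderiv_fun_mul (hes.differentiable (by simp) x) (hφt.differentiable (by simp) x)]
    have h1 : fderiv ℝ (φ t) x (EuclideanSpace.single j 1) =
      dirD (spaceDir j) (fun p => φ p.1 p.2) (t, x) := fderiv_space hf.differentiable t x j
    simp only [add_apply, smul_apply, smul_eq_mul, hde]
    rw [h1]
    field_simp
    ring
  have hL : ∀ j, LocSchwartz (fun p => (t : ℂ) * dirD (spaceDir j) (fun p => φ p.1 p.2) p -
      Complex.I / 2 * (coordC j p * φ p.1 p.2)) := fun j =>
    ((hf.dirD _).const_mul _).sub ((hf.coord_mul j).const_mul _)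
  have hfd : ∀ x, ‖fderiv ℝ (fun x => e x * φ t x) x‖ ^ 2 ≤ (t⁻¹) ^ 2 * ∑ j : Fin 3,
      ‖t * dirD (spaceDir j) (fun p => φ p.1 p.2) (t, x) -
        Complex.I / 2 * (coordC j (t, x) * φ t x)‖ ^ 2 := by
    intro x
    refine (norm_sq_le_sum_norm_sq _).trans_eq ?_
    rw [Finset.mul_sum]
    refine Finset.sum_congr rfl fun j _ => ?_
    rw [hdu, norm_mul, hen, one_mul, norm_mul, mul_pow, norm_inv, Complex.norm_real,
      Real.norm_of_nonneg ht.le]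
  have hint : Integrable (fun x => (t⁻¹) ^ 2 * ∑ j : Fin 3,
      ‖t * dirD (spaceDir j) (fun p => φ p.1 p.2) (t, x) -
        Complex.I / 2 * (coordC j (t, x) * φ t x)‖ ^ 2) :=
    (integrable_finsetSum _ fun j _ =>
      (continuous_norm_sq_decay (φ := fun t' x =>
        (t : ℂ) * dirD (spaceDir j) (fun p => φ p.1 p.2) (t', x) -
          Complex.I / 2 * (coordC j (t', x) * φ t' x)) (hL j) t).2.1).const_mul _
  have hi2 : Integrable (fun x => ‖fderiv ℝ (fun x => e x * φ t x) x‖ ^ 2) :=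
    hint.mono' ((hus.continuous_fderiv (by simp)).norm.pow 2).aestronglyMeasurable
      (Filter.Eventually.of_forall fun x => by
        rw [Real.norm_of_nonneg (by positivity)]
        exact hfd x)
  have key := hGN (fun x => e x * φ t x) hus
    (by simpa only [hun] using (continuous_norm_sq_decay hf t).2.1) hi2
  simp only [hun] at key
  have hk : ∫ x, ‖fderiv ℝ (fun x => e x * φ t x) x‖ ^ 2 ≤ (t⁻¹) ^ 2 * pseudoKinetic φ t := by
    rw [pseudoKinetic, ← integral_const_mul]
    exact integral_mono hi2 hint hfd
  have hk' : √(∫ x, ‖fderiv ℝ (fun x => e x * φ t x) x‖ ^ 2) ≤ √(pseudoKinetic φ t) / t := by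
    refine (Real.sqrt_le_sqrt hk).trans_eq ?_
    rw [Real.sqrt_mul (by positivity), Real.sqrt_sq (by positivity)]
    ring
  simp only [← pow_mul]
  refine key.trans ?_
  rw [integral_norm_sq_eq hφ t 0, ← mul_assoc]
  gcongr

theorem le_of_hasDerivAt_nonpos {G G' : ℝ → ℝ} (hd : ∀ t, 1 ≤ t → HasDerivAt G (G' t) t)
    (hG' : ∀ t, 1 ≤ t → G' t ≤ 0) {t : ℝ} (ht : 1 ≤ t) : G t ≤ G 1 := by
  have h : AntitoneOn G (Set.Ici 1) := by
    refine antitoneOn_of_deriv_nonpos (convex_Ici 1)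
      (fun t ht => (hd t ht).continuousAt.continuousWithinAt) (fun t ht => ?_) (fun t ht => ?_)
    · exact (hd t (interior_subset ht)).differentiableAt.differentiableWithinAt
    · rw [(hd t (interior_subset ht)).deriv]
      exact hG' t (interior_subset ht)
  exact h (Set.mem_Ici.2 le_rfl) (Set.mem_Ici.2 ht) ht

/-- A bootstrap argument: linear growth of the pseudoconformal energy and the decay it entails for
the interaction energy improve to boundedness. -/
theorem exists_bound_of_pseudoconformal {K Q : ℝ → ℝ} {C : ℝ} (hC : 0 ≤ C) (hK : ∀ t, 0 ≤ K t)
    (hQ : ∀ t, 0 ≤ Q t) (hQK : ∀ t, 0 < t → Q t ≤ C * (√(K t) / t) ^ 3)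
    (hE : ∀ t, 0 < t → ∃ E', HasDerivAt (fun s => K s + s ^ 2 / 2 * Q s) E' t ∧
      E' ≤ t / 2 * Q t) : ∃ B, 0 ≤ B ∧ ∀ t, 1 ≤ t → K t ≤ B := by
  set E : ℝ → ℝ := fun s => K s + s ^ 2 / 2 * Q s with hEdef
  have hE0 : ∀ t, 0 ≤ E t := fun t => add_nonneg (hK t) (mul_nonneg (by positivity) (hQ t))
  have hKE : ∀ t, K t ≤ E t := fun t => le_add_of_nonneg_right (mul_nonneg (by positivity) (hQ t))
  have hpos : ∀ t : ℝ, 1 ≤ t → 0 < t := fun t ht => by linarith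
  choose! E' hd hE' using hE
  have lin : ∀ t, 1 ≤ t → E t ≤ E 1 * t := by
    intro t ht
    have h := le_of_hasDerivAt_nonpos (G := fun t => E t / t)
      (fun t ht => (hd t (hpos t ht)).div (hasDerivAt_id t) (hpos t ht).ne')
      (fun t ht => by
        refine div_nonpos_of_nonpos_of_nonneg ?_ (sq_nonneg _)
        have h1 := mul_le_mul_of_nonneg_right (hE' t (hpos t ht)) (hpos t ht).le
        have h2 := hK t
        simp only [hEdef]
        linarith) ht
    simp only [div_one] at h
    rwa [div_le_iff₀ (hpos t ht)] at h
  set D : ℝ := C / 2 * √(E 1) with hD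
  have hD0 : 0 ≤ D := by positivity
  have hE'' : ∀ t, 1 ≤ t → E' t ≤ D * (t * √t)⁻¹ * E t := by
    intro t ht
    have ht0 := hpos t ht
    have hs : 0 < √t := Real.sqrt_pos.2 ht0
    have h1 : √(K t) ≤ √(E 1) * √t := by
      rw [← Real.sqrt_mul (hE0 1)]
      exact Real.sqrt_le_sqrt ((hKE t).trans (lin t ht))
    have h2 : √(K t) ^ 3 ≤ √(E 1) * √t * E t := by
      calc √(K t) ^ 3 = √(K t) * √(K t) ^ 2 := by ring
        _ = √(K t) * K t := by rw [Real.sq_sqrt (hK t)]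
        _ ≤ √(E 1) * √t * E t := mul_le_mul h1 (hKE t) (hK t) (by positivity)
    calc E' t ≤ t / 2 * Q t := hE' t ht0
      _ ≤ t / 2 * (C * (√(K t) / t) ^ 3) := by gcongr; exact hQK t ht0
      _ = C / 2 * (t ^ 2)⁻¹ * √(K t) ^ 3 := by field_simp
      _ ≤ C / 2 * (t ^ 2)⁻¹ * (√(E 1) * √t * E t) := by gcongr
      _ = D * (t * √t)⁻¹ * E t := by
        have h3 : (t ^ 2)⁻¹ * √t = (t * √t)⁻¹ := by
          field_simp
          rw [Real.sq_sqrt ht0.le]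
        rw [hD, ← h3]
        ring
  refine ⟨E 1 * Real.exp (2 * D), mul_nonneg (hE0 1) (Real.exp_nonneg _), fun t ht => ?_⟩
  have h := le_of_hasDerivAt_nonpos (G := fun t => E t * Real.exp (2 * D * (√t)⁻¹))
    (fun t ht => (hd t (hpos t ht)).mul ((((Real.hasDerivAt_sqrt (hpos t ht).ne').inv
      (Real.sqrt_pos.2 (hpos t ht)).ne').const_mul (2 * D)).exp))
    (fun t ht => by
      have ht0 := hpos t ht
      have hs : 0 < √t := Real.sqrt_pos.2 ht0
      have e : 2 * D * (-(1 / (2 * √t)) / √t ^ 2) = -(D * (t * √t)⁻¹) := by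
        rw [Real.sq_sqrt ht0.le]
        field_simp
      rw [e, Pi.inv_apply]
      have h1 := mul_le_mul_of_nonneg_right (hE'' t ht) (Real.exp_nonneg (2 * D * (√t)⁻¹))
      linarith) ht
  simp only [Real.sqrt_one, inv_one, mul_one] at h
  refine (hKE t).trans (le_trans ?_ h)
  exact le_mul_of_one_le_right (hE0 t) (Real.one_le_exp (by positivity))

theorem exists_integral_norm_pow_four_decay {v : E3 → ℝ} {χ : ℝ → ℝ} {φ : ℝ → E3 → ℂ}
    (hχ : IsCutoff χ) (hχv : ∀ x : E3, x ≠ 0 → v x = χ ‖x‖ / ‖x‖) (hφ : IsHartreeSolution v φ) :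
    ∃ B, 0 ≤ B ∧ ∀ t, 1 ≤ t → ∫ x, (‖φ t x‖ ^ 2) ^ 2 ≤ B * (t ^ 3)⁻¹ := by
  obtain ⟨C, hC, hdec⟩ := integral_norm_pow_four_le_pseudoKinetic hφ
  have hv0 := potential_nonneg hχ hχv
  have hvi : 0 ≤ ∫ z, v z := integral_nonneg_of_ae hv0
  obtain ⟨B, hB, hKB⟩ := exists_bound_of_pseudoconformal (K := pseudoKinetic φ)
    (Q := hartreeEnergy v φ) (C := (∫ z, v z) * C) (by positivity) (pseudoKinetic_nonneg φ)
    (fun t => interaction_nonneg hv0 (fun x => sq_nonneg _) (fun x => sq_nonneg _))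
    (fun t ht => by
      obtain ⟨h1, -, A, h2⟩ := continuous_norm_sq_decay hφ.locSchwartz t
      refine (interaction_self_le hv0 (integrable_potential hχ hχv) h1 h2).trans ?_
      rw [mul_assoc]
      exact mul_le_mul_of_nonneg_left (hdec t ht) hvi)
    (hasDerivAt_pseudoconformal hχ hχv hφ)
  refine ⟨C * √B ^ 3, by positivity, fun t ht => (hdec t (by linarith)).trans ?_⟩
  rw [div_pow, div_eq_mul_inv, ← mul_assoc]
  gcongr
  exact hKB t ht

theorem eLpNorm_kernel_sq_le {v : E3 → ℝ} {χ : ℝ → ℝ} {u : E3 → ℂ} {C : ℝ} (hχ : IsCutoff χ)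
    (hχv : ∀ x : E3, x ≠ 0 → v x = χ ‖x‖ / ‖x‖) (hu : Continuous u)
    (hC : ∀ x, |‖u x‖ ^ 2| ≤ C * decayWeight x) :
    eLpNorm (fun p : E3 × E3 =>
      (v (p.1 - p.2) : ℂ) * starRingEnd ℂ (u p.1) * starRingEnd ℂ (u p.2)) 2 volume ^ 2 ≤
      ENNReal.ofReal ((∫ z, v z ^ 2) * ∫ x, (‖u x‖ ^ 2) ^ 2) := by
  have hv2 := integrable_potential_sq hχ hχv
  have hu2 : Continuous (fun x => ‖u x‖ ^ 2) := hu.norm.pow 2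
  have h0 : ∀ p : E3 × E3, 0 ≤ v p.2 ^ 2 * (‖u p.1‖ ^ 2 * ‖u (p.1 - p.2)‖ ^ 2) :=
    fun p => by positivity
  have hi := integrable_interaction hv2 hu2 hu2 hC hC
  have e1 : eLpNorm (fun p : E3 × E3 =>
      (v (p.1 - p.2) : ℂ) * starRingEnd ℂ (u p.1) * starRingEnd ℂ (u p.2)) 2 volume ^ 2 =
      ∫⁻ p : E3 × E3, ENNReal.ofReal (v (p.1 - p.2) ^ 2 * (‖u p.1‖ ^ 2 * ‖u p.2‖ ^ 2)) := by
    rw [eLpNorm_eq_lintegral_rpow_enorm_toReal (by simp) (by simp), ← ENNReal.rpow_natCast,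
      ← ENNReal.rpow_mul]
    simp only [ENNReal.toReal_ofNat]
    norm_num
    refine lintegral_congr fun p => ?_
    simp only [← ofReal_norm, Complex.norm_real]
    rw [← ENNReal.ofReal_mul (by positivity), ← ENNReal.ofReal_mul (by positivity),
      ← ENNReal.ofReal_pow (by positivity)]
    congr 1
    rw [Real.norm_eq_abs, mul_pow, mul_pow, sq_abs]
    ring
  rw [e1, Measure.volume_eq_prod]
  refine (lintegral_prod_le _).trans ?_
  have e2 : ∀ x : E3, ∫⁻ y, ENNReal.ofReal (v (x - y) ^ 2 * (‖u x‖ ^ 2 * ‖u y‖ ^ 2)) =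
      ∫⁻ z, ENNReal.ofReal (v z ^ 2 * (‖u x‖ ^ 2 * ‖u (x - z)‖ ^ 2)) := by
    intro x
    rw [← lintegral_sub_left_eq_self _ x]
    simp only [sub_sub_cancel]
  simp only [e2]
  rw [← lintegral_prod (fun p : E3 × E3 =>
      ENNReal.ofReal (v p.2 ^ 2 * (‖u p.1‖ ^ 2 * ‖u (p.1 - p.2)‖ ^ 2)))
      hi.aestronglyMeasurable.aemeasurable.ennreal_ofReal,
    ← Measure.volume_eq_prod,
    ← ofReal_integral_eq_lintegral_ofReal hi (Filter.Eventually.of_forall h0)]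
  exact ENNReal.ofReal_le_ofReal (interaction_self_le
    (Filter.Eventually.of_forall fun x => sq_nonneg (v x)) hv2 hu2 hC)

/-- Time integrability of the kernel `m(t,x,y) = v(x−y) conj(φ(t,x)) conj(φ(t,y))`:
`∫_1^∞ ‖m(t,·,·)‖_{L²(ℝ³×ℝ³)} dt < ∞`. -/
theorem kernel_m_time_integrable (v : E3 → ℝ) (χ : ℝ → ℝ) (hχ : IsCutoff χ)
    (hv : ∀ x : E3, x ≠ 0 → v x = χ ‖x‖ / ‖x‖)
    (φ : ℝ → E3 → ℂ) (hφ : IsHartreeSolution v φ) :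
    (∫⁻ t in Set.Ici (1:ℝ),
      eLpNorm (fun p : E3 × E3 =>
        (v (p.1 - p.2) : ℂ) * starRingEnd ℂ (φ t p.1) * starRingEnd ℂ (φ t p.2)) 2 volume) < ⊤ := by
  obtain ⟨B, hB, hdec⟩ := exists_integral_norm_pow_four_decay hχ hv hφ
  have hV : 0 ≤ ∫ z, v z ^ 2 := integral_nonneg fun z => sq_nonneg _
  set D : ℝ := √((∫ z, v z ^ 2) * B) with hD
  have hbound : ∀ t ∈ Set.Ici (1 : ℝ), eLpNorm (fun p : E3 × E3 =>
      (v (p.1 - p.2) : ℂ) * starRingEnd ℂ (φ t p.1) * starRingEnd ℂ (φ t p.2)) 2 volume ≤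
      ENNReal.ofReal (D * t ^ (-(3 / 2) : ℝ)) := by
    intro t ht
    have ht0 : 0 < t := lt_of_lt_of_le one_pos ht
    obtain ⟨-, -, A, hA⟩ := continuous_norm_sq_decay hφ.locSchwartz t
    have h := eLpNorm_kernel_sq_le hχ hv
      (hφ.locSchwartz.continuous.comp (Continuous.prodMk_right t)) hA
    have h1 : (∫ z, v z ^ 2) * ∫ x, (‖φ t x‖ ^ 2) ^ 2 ≤ (D * t ^ (-(3 / 2) : ℝ)) ^ 2 := by
      rw [mul_pow, hD, Real.sq_sqrt (by positivity), ← Real.rpow_mul_natCast ht0.le, mul_assoc]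
      refine mul_le_mul_of_nonneg_left ((hdec t ht).trans_eq ?_) hV
      rw [← Real.rpow_natCast, ← Real.rpow_neg ht0.le]
      norm_num
    have h2 := h.trans (ENNReal.ofReal_le_ofReal h1)
    rw [ENNReal.ofReal_pow (by positivity)] at h2
    exact (ENNReal.pow_le_pow_left_iff two_ne_zero).1 h2
  refine (setLIntegral_mono_ae' measurableSet_Ici
    (Filter.Eventually.of_forall hbound)).trans_lt ?_
  have hint : IntegrableOn (fun t : ℝ => D * t ^ (-(3 / 2) : ℝ)) (Set.Ici 1) :=
    ((integrableOn_Ici_iff_integrableOn_Ioi (by finiteness)).2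
      (integrableOn_Ioi_rpow_of_lt (by norm_num) one_pos)).const_mul D
  exact hint.lintegral_lt_top
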